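/- arXiv:1310.5801 — 2 statements merged into one kernel-verified Lean document; each statement's English description precedes it below -/
import Mathlib

section
/- Let ω : (0,1] → (0,∞) be an increasing function such that ω(t)/t^{1−ε} is decreasing on (0,1] for some ε > 0, and such that ∫_0^1 ω²(t)/t dt = ∞. Then the Hadamard gap series f(z) = Σ_{k=0}^∞ ω(2^{-k}) z^{2^k} defines a holomorphic function on the unit disc B_1 which belongs to B^ω(B_1) and which has a finite radial limit lim_{r→1⁻} f(rζ) at σ_1-almost no point ζ of the unit circle. -/
open MeasureTheory Metric Set Filter

/-- The normalized Lebesgue (arclength) measure `σ_1` on the unit circle. -/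
noncomputable def sigma1 : Measure (sphere (0 : ℂ) 1) :=
  ((volume : Measure ℂ).toSphere Set.univ)⁻¹ • (volume : Measure ℂ).toSphere

open scoped Pointwise in
lemma toSphere_rot (u : sphere (0 : ℂ) 1) (s : Set (sphere (0 : ℂ) 1)) (hs : MeasurableSet s) :
    (volume : Measure ℂ).toSphere ((fun x => u * x) ⁻¹' s) = (volume : Measure ℂ).toSphere s := by
  have hm : Measurable (fun x : sphere (0 : ℂ) 1 => u * x) := (continuous_const_mul u).measurable
  rw [Measure.toSphere_apply' _ hs, Measure.toSphere_apply' _ (hm hs)]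
  congr 1
  let e : ℂ ≃ₗᵢ[ℝ] ℂ := rotation u
  have he : ∀ z, e z = u.1 * z := fun z => rfl
  have h1 := e.measurePreserving.measure_preimage_equiv (f := e.toHomeomorph.toMeasurableEquiv)
    (Ioo (0 : ℝ) 1 • ((↑) '' s : Set ℂ))
  rw [← h1]
  congr 1
  ext z
  constructor
  · rintro ⟨r, hr, _, ⟨x, hx, rfl⟩, rfl⟩
    refine ⟨r, hr, _, ⟨u * x, hx, rfl⟩, ?_⟩
    change r • (u.1 * x.1) = e (r • x.1)
    rw [he]; simp; ring
  · rintro ⟨r, hr, _, ⟨x, hx, rfl⟩, h⟩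
    refine ⟨r, hr, _, ⟨u⁻¹ * x, ?_, rfl⟩, ?_⟩
    · simpa using hx
    · change r • (u⁻¹ * x).1 = z
      change r • x.1 = u.1 * z at h
      have hu : u.1 ≠ 0 := by
        intro h0; have := u.2; simp [h0] at this
      rw [Metric.unitSphere.coe_mul, Metric.unitSphere.coe_inv]
      have : z = u.1⁻¹ * (r • x.1) := by rw [h]; field_simp
      rw [this]; simp; ring

instance sigma1_prob : IsProbabilityMeasure sigma1 := by
  constructor
  rw [sigma1, Measure.smul_apply, smul_eq_mul]
  apply ENNReal.inv_mul_cancel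
  · rw [Ne, Measure.measure_univ_eq_zero]; exact Measure.toSphere_ne_zero _
  · exact measure_ne_top _ _

instance sigma1_inv : sigma1.IsMulLeftInvariant := by
  constructor
  intro u
  ext s hs
  rw [Measure.map_apply (continuous_const_mul u).measurable hs, sigma1, Measure.smul_apply,
    Measure.smul_apply, toSphere_rot u s hs]

/-- monomial -/
noncomputable def monom (n : ℤ) : C(sphere (0 : ℂ) 1, ℂ) :=
  ⟨fun z => (z ^ n : sphere (0 : ℂ) 1).1, continuous_subtype_val.comp (continuous_zpow n)⟩

lemma monom_mul (m n : ℤ) (z) : monom (m + n) z = monom m z * monom n z := by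
  simp [monom, zpow_add]

lemma monom_conj (m : ℤ) (z) : (starRingEnd ℂ) (monom m z) = monom (-m) z := by
  change (starRingEnd ℂ) (z ^ m).1 = (z ^ (-m)).1
  rw [zpow_neg, Metric.unitSphere.coe_inv, Complex.inv_def, Complex.normSq_eq_norm_sq]
  have : ‖((z ^ m : sphere (0 : ℂ) 1) : ℂ)‖ = 1 := by simpa using (z ^ m).2
  rw [this]; simp

lemma monom_int (n : ℤ) (hn : n ≠ 0) : ∫ z, monom n z ∂sigma1 = 0 := by
  have hu : ‖Complex.exp (((Real.pi / n : ℝ) : ℂ) * Complex.I)‖ = 1 := Complex.norm_exp_ofReal_mul_I _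
  refine integral_eq_zero_of_mul_left_eq_neg (μ := sigma1)
    (g := ⟨Complex.exp (((Real.pi / n : ℝ) : ℂ) * Complex.I), by rw [mem_sphere_zero_iff_norm]; exact hu⟩) ?_
  intro x
  simp only [monom, ContinuousMap.coe_mk, mul_zpow, Metric.unitSphere.coe_mul,
    Metric.unitSphere.coe_zpow]
  rw [← Complex.exp_int_mul]
  have : (n : ℂ) * (((Real.pi / n : ℝ) : ℂ) * Complex.I) = Real.pi * Complex.I := by
    have : (n : ℂ) ≠ 0 := by exact_mod_cast hn
    push_cast; field_simp
  rw [this, Complex.exp_pi_mul_I]; ring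

lemma monom_orth : Orthonormal ℂ
    (fun n : ℤ => ContinuousMap.toLp (E := ℂ) 2 sigma1 ℂ (monom n)) := by
  rw [orthonormal_iff_ite]
  intro i j
  rw [ContinuousMap.inner_toLp sigma1 (monom i) (monom j)]
  simp_rw [monom_conj, ← monom_mul]
  split_ifs with h
  · subst h; simp [monom]
  · exact monom_int _ (by omega)

lemma coef_summable (E : Set (sphere (0 : ℂ) 1)) (hE : MeasurableSet E) :
    Summable fun n : ℤ => ‖∫ z in E, monom n z ∂sigma1‖ ^ 2 := by
  have hm : MemLp (E.indicator (fun _ => (1 : ℂ))) 2 sigma1 :=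
    memLp_indicator_const _ hE _ (Or.inr (measure_ne_top _ _))
  have h := monom_orth.inner_products_summable (x := hm.toLp)
  have h2 := h.comp_injective (neg_injective (G := ℤ))
  refine h2.congr fun n => ?_
  rw [Function.comp_apply]
  symm
  congr 2
  rw [L2.inner_def, ← integral_indicator hE]
  apply integral_congr_ae
  filter_upwards [hm.coeFn_toLp, ContinuousMap.coeFn_toLp (p := 2) (𝕜 := ℂ) sigma1 (monom (-n))] with z h1 h2
  rw [h1, h2, RCLike.inner_apply, monom_conj]
  by_cases hz : z ∈ E <;> simp [hz]

lemma two_pow_add {a b c d : ℕ} (h : 2 ^ a + 2 ^ b = 2 ^ c + 2 ^ d) :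
    (a = c ∧ b = d) ∨ (a = d ∧ b = c) := by
  have key : ∀ a b c d : ℕ, a ≤ b → c ≤ d → 2 ^ a + 2 ^ b = 2 ^ c + 2 ^ d → ¬ a < c := by
    intro a b c d hab hcd h hac
    obtain ⟨k, rfl⟩ := Nat.exists_eq_add_of_le hab
    obtain ⟨l, rfl⟩ := Nat.exists_eq_add_of_lt hac
    obtain ⟨m, rfl⟩ := Nat.exists_eq_add_of_le hcd
    have hp : 0 < 2 ^ a := by positivity
    have h3 : 1 + 2 ^ k = 2 * 2 ^ l + 2 * 2 ^ l * 2 ^ m := by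
      apply Nat.eq_of_mul_eq_mul_left hp
      simp only [pow_add, pow_one] at h
      linarith
    have hl : 1 ≤ 2 ^ l := Nat.one_le_two_pow
    have hmm : 1 ≤ 2 ^ m := Nat.one_le_two_pow
    rcases k with _ | k
    · nlinarith
    · rw [pow_succ, mul_assoc] at h3; omega
  have key2 : ∀ a b c d : ℕ, a ≤ b → c ≤ d → 2 ^ a + 2 ^ b = 2 ^ c + 2 ^ d → a = c ∧ b = d := by
    intro a b c d hab hcd h
    have h1 := key a b c d hab hcd h
    have h2 := key c d a b hcd hab h.symm
    have h3 : a = c := by omega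
    subst h3
    exact ⟨rfl, Nat.pow_right_injective le_rfl (by simpa using h)⟩
  rcases le_total a b with hab | hab <;> rcases le_total c d with hcd | hcd
  · exact Or.inl (key2 _ _ _ _ hab hcd h)
  · exact Or.inr (key2 _ _ _ _ hab hcd (by omega))
  · have := key2 b a c d hab hcd (by omega); omega
  · have := key2 b a d c hab hcd (by omega); omega

lemma pair_summable (E : Set (sphere (0 : ℂ) 1)) (hE : MeasurableSet E) :
    Summable fun p : ℕ × ℕ => if p.1 = p.2 then 0 else
      ‖∫ z in E, monom (2 ^ p.2 - 2 ^ p.1) z ∂sigma1‖ ^ 2 := by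
  have hinj : Function.Injective (fun p : {p : ℕ × ℕ | p.1 ≠ p.2} => (2 ^ p.1.2 - 2 ^ p.1.1 : ℤ)) := by
    rintro ⟨⟨a, b⟩, h⟩ ⟨⟨c, d⟩, h'⟩ heq
    simp only [Set.mem_ofPred_eq] at h h' heq
    have : 2 ^ b + 2 ^ c = 2 ^ d + 2 ^ a := by
      zify; linarith
    have := two_pow_add this
    simp only [Subtype.mk.injEq, Prod.mk.injEq]
    omega
  have h := (coef_summable E hE).comp_injective hinj
  have h2 := (summable_subtype_iff_indicator
    (f := fun p : ℕ × ℕ => ‖∫ z in E, monom (2 ^ p.2 - 2 ^ p.1) z ∂sigma1‖ ^ 2)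
    (s := {p : ℕ × ℕ | p.1 ≠ p.2})).1 h
  refine h2.congr ?_
  intro p
  by_cases hp : p.1 = p.2 <;> simp [hp]

lemma monom_nat (k : ℕ) (z : sphere (0 : ℂ) 1) : monom (2 ^ k) z = z.1 ^ (2 ^ k) := by
  have : ((2 : ℤ) ^ k) = ((2 ^ k : ℕ) : ℤ) := by push_cast; rfl
  rw [this]
  change (z ^ ((2 ^ k : ℕ) : ℤ)).1 = _
  rw [zpow_natCast, Metric.unitSphere.coe_pow]

lemma zyg (E : Set (sphere (0 : ℂ) 1)) (hE : MeasurableSet E) (hE0 : sigma1 E ≠ 0) :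
    ∃ N : ℕ, ∀ M : ℕ, ∀ c : ℕ → ℝ,
      sigma1.real E / 2 * ∑ k ∈ Finset.Ico N M, c k ^ 2 ≤
      ∫ z in E, ‖∑ k ∈ Finset.Ico N M, (c k : ℂ) * z.1 ^ (2 ^ k)‖ ^ 2 ∂sigma1 := by
  set m := sigma1.real E with hm
  have hmpos : 0 < m := by
    rw [hm, measureReal_def]; exact ENNReal.toReal_pos hE0 (measure_ne_top _ _)
  have hs := pair_summable E hE
  rw [summable_iff_vanishing_norm] at hs
  obtain ⟨s, hs⟩ := hs ((m / 2) ^ 2) (by positivity)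
  refine ⟨s.sup (fun p => p.1) + 1, fun M c => ?_⟩
  set N := s.sup (fun p => p.1) + 1
  set S := Finset.Ico N M
  have hd : Disjoint (S ×ˢ S) s := by
    rw [Finset.disjoint_left]
    rintro p hp hps
    have h1 : p.1 ≤ s.sup (fun p => p.1) := Finset.le_sup (f := fun p : ℕ × ℕ => p.1) hps
    simp only [Finset.mem_product, S, Finset.mem_Ico, N] at hp
    omega
  have hs := hs _ hd
  -- expansion
  have hexp : ∀ z : sphere (0 : ℂ) 1, ‖∑ k ∈ S, (c k : ℂ) * z.1 ^ (2 ^ k)‖ ^ 2 =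
      ∑ p ∈ S ×ˢ S, c p.1 * c p.2 * (monom (2 ^ p.2 - 2 ^ p.1) z).re := by
    intro z
    have h1 : ((‖∑ k ∈ S, (c k : ℂ) * z.1 ^ (2 ^ k)‖ ^ 2 : ℝ) : ℂ) =
      ∑ p ∈ S ×ˢ S, ((c p.1 * c p.2 : ℝ) : ℂ) * monom (2 ^ p.2 - 2 ^ p.1) z := by
      push_cast
      rw [← Complex.conj_mul', map_sum, Finset.sum_mul_sum, Finset.sum_product]
      refine Finset.sum_congr rfl fun i _ => Finset.sum_congr rfl fun j _ => ?_
      rw [sub_eq_neg_add, monom_mul, ← monom_conj, monom_nat, monom_nat]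
      simp; ring
    have h2 := congrArg Complex.re h1
    rw [Complex.ofReal_re, Complex.re_sum] at h2
    rw [h2]
    refine Finset.sum_congr rfl fun p _ => ?_
    rw [Complex.re_ofReal_mul]
  have hint : ∀ n : ℤ, Integrable (fun z => monom n z) (sigma1.restrict E) := fun n =>
    ((monom n).continuous.integrable_of_hasCompactSupport
      (HasCompactSupport.of_compactSpace _))
  have hre : ∀ n : ℤ, ∫ z in E, (monom n z).re ∂sigma1 = (∫ z in E, monom n z ∂sigma1).re :=
    fun n => integral_re (hint n)
  simp_rw [hexp]
  have hint2 : ∀ n : ℤ, Integrable (fun z => (monom n z).re) (sigma1.restrict E) :=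
    fun n => (hint n).re
  rw [integral_finsetSum _ (fun p _ => ((hint2 _).const_mul _))]
  simp_rw [integral_const_mul, hre]
  set G : ℕ × ℕ → ℝ := fun p => (∫ z in E, monom (2 ^ p.2 - 2 ^ p.1) z ∂sigma1).re with hG
  set G' : ℕ × ℕ → ℝ := fun p => if p.1 = p.2 then 0 else G p with hG'
  have hsplit : ∑ p ∈ S ×ˢ S, c p.1 * c p.2 * G p =
      m * ∑ k ∈ S, c k ^ 2 + ∑ p ∈ S ×ˢ S, c p.1 * c p.2 * G' p := by
    have hdiag : m * ∑ k ∈ S, c k ^ 2 =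
        ∑ p ∈ S ×ˢ S, c p.1 * c p.2 * (if p.1 = p.2 then m else 0) := by
      rw [Finset.sum_product, Finset.mul_sum]
      refine Finset.sum_congr rfl fun i hi => ?_
      simp only [mul_ite, mul_zero]
      rw [Finset.sum_ite_eq, if_pos hi]; ring
    rw [hdiag, ← Finset.sum_add_distrib]
    refine Finset.sum_congr rfl fun p _ => ?_
    by_cases hp : p.1 = p.2
    · have : G p = m := by
        simp [hG, hp, monom, hm]
      simp [hG', hp, this]
    · simp [hG', hp]
  have hcs := Finset.sum_mul_sq_le_sq_mul_sq (S ×ˢ S) (fun p => c p.1 * c p.2) G'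
  have hcc : ∑ p ∈ S ×ˢ S, (c p.1 * c p.2) ^ 2 = (∑ k ∈ S, c k ^ 2) ^ 2 := by
    rw [sq (∑ k ∈ S, c k ^ 2), Finset.sum_mul_sum, Finset.sum_product]
    simp_rw [mul_pow]
  have hGs : ∑ p ∈ S ×ˢ S, G' p ^ 2 ≤ (m / 2) ^ 2 := by
    refine le_trans (Finset.sum_le_sum ?_) ((le_abs_self _).trans hs.le)
    intro p _
    by_cases hp : p.1 = p.2
    · simp [hG', hp]
    · simp only [hG', hp, if_false, hG]
      rw [← sq_abs]
      gcongr
      exact Complex.abs_re_le_norm _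
  rw [hcc] at hcs
  have hA : 0 ≤ ∑ k ∈ S, c k ^ 2 := Finset.sum_nonneg fun _ _ => sq_nonneg _
  have h4 : (∑ p ∈ S ×ˢ S, c p.1 * c p.2 * G' p) ^ 2 ≤ ((∑ k ∈ S, c k ^ 2) * (m / 2)) ^ 2 := by
    rw [mul_pow]
    exact hcs.trans (mul_le_mul_of_nonneg_left hGs (sq_nonneg _))
  have h5 := (abs_le_of_sq_le_sq' h4 (by positivity)).1
  change _ ≤ ∑ p ∈ S ×ˢ S, c p.1 * c p.2 * G p
  rw [hsplit]
  linarith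

lemma gap_summable (A : ℝ) {ρ : ℝ} (h0 : 0 ≤ ρ) (h1 : ρ < 1) :
    Summable (fun k : ℕ => A * ρ ^ (2 ^ k)) := by
  apply Summable.mul_left
  refine Summable.of_nonneg_of_le (fun k => by positivity) (fun k => ?_)
    (summable_geometric_of_lt_one h0 h1)
  exact pow_le_pow_of_le_one h0 h1.le (Nat.lt_two_pow_self).le

lemma gap_sum_le {r : ℝ} (h0 : 0 ≤ r) (h1 : r < 1) (n : ℕ) :
    (∑ k ∈ Finset.range n, (2 : ℝ) ^ k * r ^ (2 ^ k)) * (1 - r) ≤ 2 := by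
  have hA : ∀ n : ℕ, ∑ k ∈ Finset.range (n + 1), (2 : ℝ) ^ k * r ^ (2 ^ k) ≤
      2 * ∑ m ∈ Finset.range (2 ^ n + 1), r ^ m := by
    intro n
    induction n with
    | zero => simp [Finset.sum_range_succ]; linarith
    | succ n ih =>
      rw [Finset.sum_range_succ, show 2 ^ (n + 1) + 1 = (2 ^ n + 1) + 2 ^ n by ring,
        Finset.sum_range_add _ (2 ^ n + 1), mul_add]
      refine add_le_add ih ?_
      have : ∑ x ∈ Finset.range (2 ^ n), r ^ (2 ^ n + 1 + x) ≥
          ∑ x ∈ Finset.range (2 ^ n), r ^ (2 ^ (n + 1)) := by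
        refine Finset.sum_le_sum fun i hi => ?_
        apply pow_le_pow_of_le_one h0 h1.le
        rw [Finset.mem_range] at hi
        rw [pow_succ]; omega
      simp only [Finset.sum_const, Finset.card_range, nsmul_eq_mul, Nat.cast_pow, Nat.cast_ofNat] at this
      rw [pow_succ (2 : ℝ) n]
      linarith
  have hB : ∑ k ∈ Finset.range n, (2 : ℝ) ^ k * r ^ (2 ^ k) ≤
      ∑ k ∈ Finset.range (n + 1), (2 : ℝ) ^ k * r ^ (2 ^ k) := by
    rw [Finset.sum_range_succ]
    have : 0 ≤ (2 : ℝ) ^ n * r ^ (2 ^ n) := by positivity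
    linarith
  have hC := geom_sum_mul_neg r (2 ^ n + 1)
  have hD : 0 ≤ r ^ (2 ^ n + 1) := by positivity
  calc _ ≤ (2 * ∑ m ∈ Finset.range (2 ^ n + 1), r ^ m) * (1 - r) := by
        apply mul_le_mul_of_nonneg_right (hB.trans (hA n)); linarith
    _ = 2 * ((∑ m ∈ Finset.range (2 ^ n + 1), r ^ m) * (1 - r)) := by ring
    _ ≤ 2 := by rw [hC]; linarith

lemma low_sum_le {ε : ℝ} (hε : 0 < ε) {t : ℝ} (ht : 0 < t) (n : ℕ) :
    ∑ k ∈ Finset.range n, (if (2 : ℝ) ^ k * t < 1 then ((2 : ℝ) ^ k * t) ^ ε else 0)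
      ≤ (1 - (2 : ℝ) ^ (-ε))⁻¹ := by
  set q := (2 : ℝ) ^ (-ε) with hq
  have hq1 : q < 1 := Real.rpow_lt_one_of_one_lt_of_neg (by norm_num) (by linarith)
  have hq0 : 0 < q := by positivity
  have hD : 0 < (1 - q)⁻¹ := by rw [inv_pos]; linarith
  have hDq : (1 - q)⁻¹ * q + 1 = (1 - q)⁻¹ := by
    have : 1 - q ≠ 0 := by linarith
    field_simp; ring
  have hA : ∀ n : ℕ, ∑ k ∈ Finset.range (n + 1), ((2 : ℝ) ^ k * t) ^ ε ≤
      (1 - q)⁻¹ * ((2 : ℝ) ^ n * t) ^ ε := by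
    intro n
    induction n with
    | zero =>
      simp only [zero_add, Finset.sum_range_one, pow_zero, one_mul]
      have : 0 ≤ t ^ ε := by positivity
      have h1 : 1 ≤ (1 - q)⁻¹ := by nlinarith
      nlinarith
    | succ n ih =>
      rw [Finset.sum_range_succ]
      have hx : ((2 : ℝ) ^ n * t) ^ ε = q * ((2 : ℝ) ^ (n + 1) * t) ^ ε := by
        have : (2 : ℝ) ^ n * t = 2⁻¹ * ((2 : ℝ) ^ (n + 1) * t) := by rw [pow_succ]; ring
        rw [this, Real.mul_rpow (by norm_num) (by positivity), hq, Real.rpow_neg (by norm_num),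
          Real.inv_rpow (by norm_num)]
      rw [hx] at ih
      calc _ ≤ (1 - q)⁻¹ * (q * ((2 : ℝ) ^ (n + 1) * t) ^ ε) + ((2 : ℝ) ^ (n + 1) * t) ^ ε := by
            linarith
        _ = ((1 - q)⁻¹ * q + 1) * ((2 : ℝ) ^ (n + 1) * t) ^ ε := by ring
        _ ≤ _ := by rw [hDq]
  induction n with
  | zero => simpa using hD.le
  | succ n ih =>
    by_cases h : (2 : ℝ) ^ n * t < 1
    · calc _ ≤ ∑ k ∈ Finset.range (n + 1), ((2 : ℝ) ^ k * t) ^ ε := by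
            refine Finset.sum_le_sum fun k _ => ?_
            split_ifs
            · exact le_rfl
            · positivity
        _ ≤ _ := hA n
        _ ≤ (1 - q)⁻¹ * 1 := by
            apply mul_le_mul_of_nonneg_left _ hD.le
            exact Real.rpow_le_one (by positivity) h.le hε.le
        _ = _ := mul_one _
    · rw [Finset.sum_range_succ, if_neg h, add_zero]; exact ih

lemma omega_sum (ω : ℝ → ℝ) (hωpos : ∀ t ∈ Set.Ioc (0 : ℝ) 1, 0 < ω t)
    (hωmono : MonotoneOn ω (Set.Ioc (0 : ℝ) 1)) {ε : ℝ} (hε : 0 < ε)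
    (hreg : AntitoneOn (fun t : ℝ => ω t / t ^ ((1 : ℝ) - ε)) (Set.Ioc (0 : ℝ) 1))
    {r : ℝ} (h0 : 0 ≤ r) (h1 : r < 1) (n : ℕ) :
    (∑ k ∈ Finset.range n, ω ((2 : ℝ)⁻¹ ^ k) * ((2 : ℝ) ^ k * r ^ (2 ^ k))) * (1 - r) ≤
      (2 + (1 - (2 : ℝ) ^ (-ε))⁻¹) * ω (1 - r) := by
  set t := 1 - r with ht
  have htm : t ∈ Ioc (0 : ℝ) 1 := ⟨by linarith, by linarith⟩
  have ht0 := htm.1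
  have hw := hωpos t htm
  have key : ∀ k, ω ((2 : ℝ)⁻¹ ^ k) * ((2 : ℝ) ^ k * r ^ (2 ^ k)) * t ≤
      ω t * (((2 : ℝ) ^ k * r ^ (2 ^ k)) * t +
        (if (2 : ℝ) ^ k * t < 1 then ((2 : ℝ) ^ k * t) ^ ε else 0)) := by
    intro k
    have hkm : (2 : ℝ)⁻¹ ^ k ∈ Ioc (0 : ℝ) 1 :=
      ⟨by positivity, pow_le_one₀ (by norm_num) (by norm_num)⟩
    have hp : (0 : ℝ) < 2 ^ k := by positivity
    have hrp : 0 ≤ r ^ (2 ^ k) := by positivity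
    have hrp1 : r ^ (2 ^ k) ≤ 1 := pow_le_one₀ h0 h1.le
    split_ifs with h
    · have hlt : t ≤ (2 : ℝ)⁻¹ ^ k := by
        rw [inv_pow, ← one_div, le_div_iff₀ hp]; linarith
      have h2 := hreg htm hkm hlt
      simp only at h2
      have hx : (2 : ℝ)⁻¹ ^ k = t / (2 ^ k * t) := by rw [inv_pow]; field_simp
      have hy : ω ((2 : ℝ)⁻¹ ^ k) ≤ ω t * (((2 : ℝ) ^ k * t) ^ ε / (2 ^ k * t)) := by
        rw [div_le_iff₀ (by have := hkm.1; positivity)] at h2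
        refine h2.trans (le_of_eq ?_)
        rw [hx]
        rw [Real.div_rpow ht0.le (by positivity), Real.rpow_sub (by positivity : 0 < 2 ^ k * t),
          Real.rpow_one]
        have : t ^ (1 - ε) ≠ 0 := by positivity
        have : ((2 : ℝ) ^ k * t) ^ ε ≠ 0 := by positivity
        field_simp
      have hz : ω ((2 : ℝ)⁻¹ ^ k) * (2 ^ k * t) ≤ ω t * ((2 : ℝ) ^ k * t) ^ ε := by
        calc _ ≤ ω t * (((2 : ℝ) ^ k * t) ^ ε / (2 ^ k * t)) * (2 ^ k * t) := by gcongr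
          _ = _ := by field_simp
      have hpos := hωpos _ hkm
      calc ω ((2 : ℝ)⁻¹ ^ k) * ((2 : ℝ) ^ k * r ^ (2 ^ k)) * t
          = ω ((2 : ℝ)⁻¹ ^ k) * (2 ^ k * t) * r ^ (2 ^ k) := by ring
        _ ≤ ω ((2 : ℝ)⁻¹ ^ k) * (2 ^ k * t) * 1 := by gcongr
        _ ≤ ω t * ((2 : ℝ) ^ k * t) ^ ε := by linarith
        _ ≤ _ := by
            gcongr
            have : 0 ≤ (2 : ℝ) ^ k * r ^ (2 ^ k) * t := by positivity
            linarith
    · have hlt : (2 : ℝ)⁻¹ ^ k ≤ t := by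
        rw [inv_pow, ← one_div, div_le_iff₀ hp]; linarith
      have := hωmono hkm htm hlt
      rw [add_zero, mul_assoc]
      gcongr
  rw [Finset.sum_mul]
  refine (Finset.sum_le_sum fun k _ => key k).trans ?_
  rw [← Finset.mul_sum, Finset.sum_add_distrib, ← Finset.sum_mul, mul_comm]
  gcongr
  · exact gap_sum_le h0 h1 n
  · exact low_sum_le hε ht0 n

lemma not_summable_sq (ω : ℝ → ℝ) (hωpos : ∀ t ∈ Set.Ioc (0 : ℝ) 1, 0 < ω t)
    (hωmono : MonotoneOn ω (Set.Ioc (0 : ℝ) 1))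
    (hint : ∫⁻ t in Set.Ioc (0 : ℝ) 1, ENNReal.ofReal (ω t ^ 2 / t) = ⊤) :
    ¬ Summable (fun k : ℕ => ω ((2 : ℝ)⁻¹ ^ k) ^ 2) := by
  intro hs
  have hsub : Ioc (0 : ℝ) 1 ⊆ ⋃ k : ℕ, Ioc ((2 : ℝ)⁻¹ ^ (k + 1)) ((2 : ℝ)⁻¹ ^ k) := by
    intro t ht
    obtain ⟨n, h1, h2⟩ := exists_nat_pow_near_of_lt_one ht.1 ht.2 (y := (2 : ℝ)⁻¹)
      (by norm_num) (by norm_num)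
    exact mem_iUnion.2 ⟨n, h1, h2⟩
  have h1 : ∀ k : ℕ, ∫⁻ t in Ioc ((2 : ℝ)⁻¹ ^ (k + 1)) ((2 : ℝ)⁻¹ ^ k),
      ENNReal.ofReal (ω t ^ 2 / t) ≤ ENNReal.ofReal (ω ((2 : ℝ)⁻¹ ^ k) ^ 2) := by
    intro k
    have hkm : (2 : ℝ)⁻¹ ^ k ∈ Ioc (0 : ℝ) 1 :=
      ⟨by positivity, pow_le_one₀ (by norm_num) (by norm_num)⟩
    have hx : (0 : ℝ) < (2 : ℝ)⁻¹ ^ (k + 1) := by positivity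
    calc _ ≤ ∫⁻ t in Ioc ((2 : ℝ)⁻¹ ^ (k + 1)) ((2 : ℝ)⁻¹ ^ k),
          ENNReal.ofReal (ω ((2 : ℝ)⁻¹ ^ k) ^ 2 / (2 : ℝ)⁻¹ ^ (k + 1)) := by
          refine setLIntegral_mono' measurableSet_Ioc fun t ht => ?_
          apply ENNReal.ofReal_le_ofReal
          have htm : t ∈ Ioc (0 : ℝ) 1 := ⟨hx.trans ht.1, ht.2.trans hkm.2⟩
          have := hωmono htm hkm ht.2
          have := hωpos t htm
          have := ht.1.le
          gcongr
      _ = _ := by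
          rw [setLIntegral_const, Real.volume_Ioc, ← ENNReal.ofReal_mul (by positivity)]
          congr 1
          have h3 : (2 : ℝ)⁻¹ ^ k - (2 : ℝ)⁻¹ ^ (k + 1) = (2 : ℝ)⁻¹ ^ (k + 1) := by
            rw [pow_succ]; ring
          rw [h3, div_mul_cancel₀ _ hx.ne']
  have h2 : ∫⁻ t in Set.Ioc (0 : ℝ) 1, ENNReal.ofReal (ω t ^ 2 / t) ≤
      ENNReal.ofReal (∑' k : ℕ, ω ((2 : ℝ)⁻¹ ^ k) ^ 2) := by
    calc _ ≤ ∫⁻ t in ⋃ k : ℕ, Ioc ((2 : ℝ)⁻¹ ^ (k + 1)) ((2 : ℝ)⁻¹ ^ k),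
          ENNReal.ofReal (ω t ^ 2 / t) := lintegral_mono_set hsub
      _ ≤ ∑' k : ℕ, ∫⁻ t in Ioc ((2 : ℝ)⁻¹ ^ (k + 1)) ((2 : ℝ)⁻¹ ^ k),
          ENNReal.ofReal (ω t ^ 2 / t) := lintegral_iUnion_le _ _
      _ ≤ ∑' k : ℕ, ENNReal.ofReal (ω ((2 : ℝ)⁻¹ ^ k) ^ 2) := ENNReal.tsum_le_tsum h1
      _ = _ := (ENNReal.ofReal_tsum_of_nonneg (fun _ => sq_nonneg _) hs).symm
  rw [hint] at h2
  exact ENNReal.ofReal_ne_top (top_le_iff.1 h2)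

section gap
variable {a : ℕ → ℝ} {A : ℝ}

lemma gap_term_le (ha0 : ∀ k, 0 ≤ a k) (haA : ∀ k, a k ≤ A) {ρ : ℝ} {z : ℂ}
    (hz : ‖z‖ ≤ ρ) (k : ℕ) : ‖(a k : ℂ) * z ^ (2 ^ k)‖ ≤ A * ρ ^ (2 ^ k) := by
  have h1 := ha0 k
  have h2 := haA k
  rw [norm_mul, norm_pow, Complex.norm_real, Real.norm_of_nonneg h1]
  have : 0 ≤ A := h1.trans h2
  gcongr

lemma gap_hasSum (ha0 : ∀ k, 0 ≤ a k) (haA : ∀ k, a k ≤ A) {z : ℂ} (hz : ‖z‖ < 1) :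
    HasSum (fun k : ℕ => (a k : ℂ) * z ^ (2 ^ k)) (∑' k : ℕ, (a k : ℂ) * z ^ (2 ^ k)) :=
  (Summable.of_norm_bounded (gap_summable A (norm_nonneg z) hz)
    (gap_term_le ha0 haA le_rfl)).hasSum

lemma gap_diff (ha0 : ∀ k, 0 ≤ a k) (haA : ∀ k, a k ≤ A) {z : ℂ} (hz : ‖z‖ < 1) :
    DifferentiableAt ℂ (fun z : ℂ => ∑' k : ℕ, (a k : ℂ) * z ^ (2 ^ k)) z ∧
    HasSum (fun k : ℕ => (a k : ℂ) * (2 ^ k * z ^ (2 ^ k)))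
      (z * deriv (fun z : ℂ => ∑' k : ℕ, (a k : ℂ) * z ^ (2 ^ k)) z) := by
  obtain ⟨ρ, h1, h2⟩ := exists_between hz
  have hρ : 0 ≤ ρ := (norm_nonneg z).trans h1.le
  have hzU : z ∈ ball (0 : ℂ) ρ := by simpa using h1
  have hd : ∀ k : ℕ, DifferentiableOn ℂ (fun w : ℂ => (a k : ℂ) * w ^ (2 ^ k)) (ball 0 ρ) := by
    intro k; fun_prop
  have hle : ∀ (k : ℕ) (w : ℂ), w ∈ ball (0 : ℂ) ρ → ‖(a k : ℂ) * w ^ (2 ^ k)‖ ≤ A * ρ ^ (2 ^ k) :=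
    fun k w hw => gap_term_le ha0 haA (by simpa using (mem_ball_zero_iff.1 hw).le) k
  refine ⟨(Complex.differentiableOn_tsum_of_summable_norm (gap_summable A hρ h2) hd isOpen_ball
    hle).differentiableAt (isOpen_ball.mem_nhds hzU), ?_⟩
  have h := (Complex.hasSum_deriv_of_summable_norm (gap_summable A hρ h2) hd isOpen_ball
    hle hzU).mul_left z
  have hfun : (fun k : ℕ => (a k : ℂ) * (2 ^ k * z ^ (2 ^ k))) =
      fun i : ℕ => z * deriv (fun w : ℂ => (a i : ℂ) * w ^ (2 ^ i)) z := ?_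
  · rw [hfun]; exact h
  funext k
  rw [deriv_const_mul _ (by fun_prop), deriv_pow_field]
  push_cast
  have : z ^ (2 ^ k) = z ^ (2 ^ k - 1) * z := by
    rw [← pow_succ, Nat.sub_add_cancel Nat.one_le_two_pow]
  rw [this]; ring

lemma gap_null (ha0 : ∀ k, 0 ≤ a k) (haA : ∀ k, a k ≤ A) (hns : ¬ Summable (fun k => a k ^ 2))
    (f : ℂ → ℂ) (hf : f = fun z : ℂ => ∑' k : ℕ, (a k : ℂ) * z ^ (2 ^ k)) (n : ℕ) :
    sigma1 {ζ | ∀ r ∈ Ico (1 - 1 / ((n : ℝ) + 1)) 1, ‖f (r • ζ.1)‖ ≤ n} = 0 := by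
  by_contra hE0
  set E : Set (sphere (0 : ℂ) 1) :=
    {ζ | ∀ r ∈ Ico (1 - 1 / ((n : ℝ) + 1)) 1, ‖f (r • ζ.1)‖ ≤ n} with hEdef
  have hA : 0 ≤ A := (ha0 0).trans (haA 0)
  have hn1 : 1 / ((n : ℝ) + 1) ≤ 1 := by
    rw [div_le_one (by positivity)]; linarith [(Nat.cast_nonneg n : (0 : ℝ) ≤ n)]
  have hn0 : 0 < 1 / ((n : ℝ) + 1) := by positivity
  have hr0 : ∀ r ∈ Ico (1 - 1 / ((n : ℝ) + 1)) 1, 0 ≤ r := fun r hr => by linarith [hr.1]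
  have hnorm : ∀ r ∈ Ico (1 - 1 / ((n : ℝ) + 1)) 1, ∀ ζ : sphere (0 : ℂ) 1, ‖r • ζ.1‖ = r := by
    intro r hr ζ
    have : ‖ζ.1‖ = 1 := mem_sphere_zero_iff_norm.1 ζ.2
    rw [norm_smul, this, Real.norm_of_nonneg (hr0 r hr), mul_one]
  have hEm : MeasurableSet E := by
    apply IsClosed.measurableSet
    have : E = ⋂ r ∈ Ico (1 - 1 / ((n : ℝ) + 1)) 1,
        {ζ : sphere (0 : ℂ) 1 | ‖f (r • ζ.1)‖ ≤ n} := by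
      ext ζ; simp [hEdef]
    rw [this]
    refine isClosed_biInter fun r hr => isClosed_le ?_ continuous_const
    refine Continuous.norm ?_
    rw [continuous_iff_continuousAt]
    intro ζ
    have h1 : ContinuousAt f (r • ζ.1) := by
      rw [hf]
      exact (gap_diff ha0 haA (by rw [hnorm r hr]; exact hr.2)).1.continuousAt
    exact ContinuousAt.comp (f := fun ζ : sphere (0 : ℂ) 1 => r • ζ.1) h1
      (by fun_prop)
  obtain ⟨N, hN⟩ := zyg E hEm hE0
  set m := sigma1.real E with hm
  have hmpos : 0 < m := by
    rw [hm, measureReal_def]; exact ENNReal.toReal_pos hE0 (measure_ne_top _ _)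
  set K : ℝ := n + 1 + N * A with hK
  have hKpos : 0 ≤ K := by positivity
  have step : ∀ r ∈ Ico (1 - 1 / ((n : ℝ) + 1)) 1, ∀ M,
      ∑ k ∈ Finset.Ico N M, (a k * r ^ (2 ^ k)) ^ 2 ≤ 2 * K ^ 2 := by
    intro r hr M
    have hrn := hr0 r hr
    have hsum := gap_summable A hrn hr.2
    have htail := tendsto_sum_nat_add (fun k : ℕ => A * r ^ (2 ^ k))
    obtain ⟨M', hM'1, hM'⟩ := ((htail.eventually_lt_const one_pos).and
      (eventually_ge_atTop (max M N))).exists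
    have hbd : ∀ ζ ∈ E, ‖∑ k ∈ Finset.Ico N M', ((a k * r ^ (2 ^ k) : ℝ) : ℂ) * ζ.1 ^ (2 ^ k)‖ ≤ K := by
      intro ζ hζ
      have hζ' := hζ r hr
      have hzn := hnorm r hr ζ
      set z : ℂ := r • ζ.1 with hz
      have hterm : ∀ k, ((a k * r ^ (2 ^ k) : ℝ) : ℂ) * ζ.1 ^ (2 ^ k) = (a k : ℂ) * z ^ (2 ^ k) := by
        intro k
        rw [hz, Complex.real_smul, mul_pow]; push_cast; ring
      simp_rw [hterm]
      have hs := gap_hasSum ha0 haA (z := z) (by rw [hzn]; exact hr.2)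
      have e1 := hs.summable.sum_add_tsum_nat_add M'
      have e2 := Finset.sum_range_add_sum_Ico (fun k => (a k : ℂ) * z ^ (2 ^ k))
        ((le_max_right M N).trans hM')
      have e3 : ‖∑' k : ℕ, (a (k + M') : ℂ) * z ^ (2 ^ (k + M'))‖ ≤ 1 := by
        refine le_trans (tsum_of_norm_bounded ((summable_nat_add_iff M').2 hsum).hasSum
          (fun k => gap_term_le ha0 haA hzn.le (k + M'))) hM'1.le
      have e4 : ‖∑ k ∈ Finset.range N, (a k : ℂ) * z ^ (2 ^ k)‖ ≤ N * A := by
        refine (norm_sum_le_of_le _ (f := fun k => (a k : ℂ) * z ^ (2 ^ k)) (n := fun _ => A) ?_).trans (by simp)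
        intro k _
        refine (gap_term_le ha0 haA hzn.le k).trans ?_
        exact mul_le_of_le_one_right hA (pow_le_one₀ hrn hr.2.le)
      have e5 : ∑ k ∈ Finset.Ico N M', (a k : ℂ) * z ^ (2 ^ k) =
          f z - (∑' k : ℕ, (a (k + M') : ℂ) * z ^ (2 ^ (k + M'))) -
            ∑ k ∈ Finset.range N, (a k : ℂ) * z ^ (2 ^ k) := by
        rw [hf]
        simp only
        rw [← e1, ← e2]; ring
      rw [e5]
      refine (norm_sub_le _ _).trans ?_
      have := norm_sub_le (f z) (∑' k : ℕ, (a (k + M') : ℂ) * z ^ (2 ^ (k + M')))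
      rw [hK]
      linarith
    have hz := hN M' (fun k => a k * r ^ (2 ^ k))
    have hup : ∫ z in E, ‖∑ k ∈ Finset.Ico N M', ((a k * r ^ (2 ^ k) : ℝ) : ℂ) * z.1 ^ (2 ^ k)‖ ^ 2 ∂sigma1
        ≤ K ^ 2 * m := by
      refine (Real.le_norm_self _).trans ?_
      refine norm_setIntegral_le_of_norm_le_const (μ := sigma1) (s := E) (measure_lt_top _ _) ?_
      intro ζ hζ
      rw [Real.norm_of_nonneg (by positivity)]
      have := hbd ζ hζ
      gcongr
    have h3 : ∑ k ∈ Finset.Ico N M', (a k * r ^ (2 ^ k)) ^ 2 ≤ 2 * K ^ 2 := by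
      have h4 := hz.trans hup
      have : m * (∑ k ∈ Finset.Ico N M', (a k * r ^ (2 ^ k)) ^ 2) ≤ m * (2 * K ^ 2) := by linarith
      exact le_of_mul_le_mul_left this hmpos
    refine le_trans (Finset.sum_le_sum_of_subset_of_nonneg ?_ (fun _ _ _ => sq_nonneg _)) h3
    exact Finset.Ico_subset_Ico_right ((le_max_left M N).trans hM')
  have fin : ∀ M, ∑ k ∈ Finset.Ico N M, a k ^ 2 ≤ 2 * K ^ 2 := by
    intro M
    have hc : Continuous (fun r : ℝ => ∑ k ∈ Finset.Ico N M, (a k * r ^ (2 ^ k)) ^ 2) := by fun_prop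
    have ht := (hc.tendsto 1).mono_left (nhdsWithin_le_nhds (s := Iio 1))
    simp only [one_pow, mul_one] at ht
    refine le_of_tendsto ht ?_
    filter_upwards [Ico_mem_nhdsLT (show 1 - 1 / ((n : ℝ) + 1) < 1 by linarith)] with r hr
    exact step r hr M
  apply hns
  rw [← summable_nat_add_iff N]
  refine summable_of_sum_range_le (c := 2 * K ^ 2) (fun _ => sq_nonneg _) fun M => ?_
  have := fin (N + M)
  rw [Finset.sum_Ico_eq_sum_range, Nat.add_sub_cancel_left] at this
  simpa [add_comm] using this

end gap

/-- for `ω` increasing with `ω(t)/t^{1-ε}` decreasing and `∫_0^1 ω²(t)/t dt = ∞`,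
the Hadamard gap series `f(z) = Σ ω(2^{-k}) z^{2^k}` is holomorphic on the disc, belongs to
`B^ω(B_1)`, and has a finite radial limit at `σ_1`-almost no point of the circle. -/
theorem stmt2 (ω : ℝ → ℝ)
    (hωpos : ∀ t ∈ Set.Ioc (0 : ℝ) 1, 0 < ω t)
    (hωmono : MonotoneOn ω (Set.Ioc (0 : ℝ) 1))
    (hωreg : ∃ ε : ℝ, 0 < ε ∧
      AntitoneOn (fun t : ℝ => ω t / t ^ ((1 : ℝ) - ε)) (Set.Ioc (0 : ℝ) 1))
    (hint : ∫⁻ t in Set.Ioc (0 : ℝ) 1, ENNReal.ofReal (ω t ^ 2 / t) = ⊤)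
    (f : ℂ → ℂ)
    (hfdef : f = fun z : ℂ => ∑' k : ℕ, (ω ((2 : ℝ)⁻¹ ^ k) : ℂ) * z ^ (2 ^ k)) :
    (∀ z ∈ ball (0 : ℂ) 1,
      HasSum (fun k : ℕ => (ω ((2 : ℝ)⁻¹ ^ k) : ℂ) * z ^ (2 ^ k)) (f z)) ∧
    DifferentiableOn ℂ f (ball 0 1) ∧
    (∃ C : ℝ, ∀ z ∈ ball (0 : ℂ) 1,
      ‖z * deriv f z‖ * (1 - ‖z‖) ≤ C * ω (1 - ‖z‖)) ∧
    ∀ᵐ ζ ∂sigma1, ¬ ∃ L : ℂ,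
      Tendsto (fun r : ℝ => f (r • ζ.1)) (nhdsWithin 1 (Set.Iio 1)) (nhds L) := by
  have hkm : ∀ k : ℕ, (2 : ℝ)⁻¹ ^ k ∈ Ioc (0 : ℝ) 1 := fun k =>
      ⟨by positivity, pow_le_one₀ (by norm_num) (by norm_num)⟩
  have ha0 : ∀ k : ℕ, 0 ≤ ω ((2 : ℝ)⁻¹ ^ k) := fun k => (hωpos _ (hkm k)).le
  have haA : ∀ k : ℕ, ω ((2 : ℝ)⁻¹ ^ k) ≤ ω 1 := fun k =>
    hωmono (hkm k) ⟨one_pos, le_rfl⟩ (hkm k).2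
  refine ⟨?_, ?_, ?_, ?_⟩
  · intro z hz
    rw [hfdef]
    exact gap_hasSum ha0 haA (mem_ball_zero_iff.1 hz)
  · intro z hz
    rw [hfdef]
    exact (gap_diff ha0 haA (mem_ball_zero_iff.1 hz)).1.differentiableWithinAt
  · obtain ⟨ε, hε, hreg⟩ := hωreg
    refine ⟨2 + (1 - (2 : ℝ) ^ (-ε))⁻¹, fun z hz => ?_⟩
    have hz1 := mem_ball_zero_iff.1 hz
    have h := (gap_diff ha0 haA hz1).2
    rw [← hfdef] at h
    have ht := (h.tendsto_sum_nat.norm).mul_const (1 - ‖z‖)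
    refine le_of_tendsto ht (Eventually.of_forall fun n => ?_)
    refine le_trans (mul_le_mul_of_nonneg_right (norm_sum_le _ _) (by linarith)) ?_
    refine le_trans (le_of_eq ?_) (omega_sum ω hωpos hωmono hε hreg (norm_nonneg z) hz1 n)
    congr 1
    refine Finset.sum_congr rfl fun k _ => ?_
    rw [norm_mul, norm_mul, norm_pow, norm_pow, Complex.norm_real, Real.norm_of_nonneg (ha0 k)]
    simp
  · have hnull := gap_null ha0 haA (not_summable_sq ω hωpos hωmono hint) f hfdef
    rw [← measure_iUnion_null_iff] at hnull
    rw [ae_iff]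
    refine measure_mono_null ?_ hnull
    intro ζ hζ
    simp only [not_not, Set.mem_ofPred_eq] at hζ
    obtain ⟨L, hL⟩ := hζ
    have h1 : ∀ᶠ r : ℝ in nhdsWithin 1 (Iio 1), ‖f (r • ζ.1)‖ < ‖L‖ + 1 :=
      hL.norm.eventually_lt_const (by linarith)
    obtain ⟨l, hl, hl2⟩ := (mem_nhdsLT_iff_exists_Ico_subset).1 h1
    have hl0 : 0 < 1 - l := by have : l < 1 := hl; linarith
    obtain ⟨n1, hn1⟩ := exists_nat_one_div_lt hl0
    obtain ⟨n2, hn2⟩ := exists_nat_ge (‖L‖ + 1)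
    refine mem_iUnion.2 ⟨max n1 n2, fun r hr => ?_⟩
    have h2 : 1 / (((max n1 n2 : ℕ) : ℝ) + 1) ≤ 1 / ((n1 : ℝ) + 1) := by
      have : (n1 : ℝ) ≤ ((max n1 n2 : ℕ) : ℝ) := by exact_mod_cast le_max_left _ _
      gcongr
    have h3 : (n2 : ℝ) ≤ ((max n1 n2 : ℕ) : ℝ) := by exact_mod_cast le_max_right _ _
    have h4 : ‖f (r • ζ.1)‖ < ‖L‖ + 1 := hl2 ⟨by linarith [hr.1], hr.2⟩
    linarith
end

section
/- Let ω, Ω : (0,1] → (0,∞) with ω increasing, Ω increasing, and Ω(t)/t^{1−ε} decreasing on (0,1] for some ε > 0. Assume ∫_0^1 ω²(t)/t dt < ∞ and ∫_0^1 Ω²(t)/t dt = ∞. Let 1 ≤ p < ∞ and let φ : B_1 → B_1 be a holomorphic mapping such that (1−r)·(∫_{S_1} (|φ′(rζ)|/(1−|φ(rζ)|) · Ω(1−|φ(rζ)|))^{2p} dσ_1(ζ))^{1/(2p)} ≤ ω(1−r) for all 0 < r < 1. Then sup_{0<r<1} ∫_{S_1} Φ_Ω^p(1−|φ(rζ)|)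 dσ_1(ζ) < ∞. -/
open MeasureTheory Metric Set Filter

/-- `Φ_ω(x) = 1 + ∫_x^1 ω(t)^2 / t dt`. -/
noncomputable def Phi (ω : ℝ → ℝ) (x : ℝ) : ℝ := 1 + ∫ t in Set.Ioc x 1, ω t ^ 2 / t

instance sigma1_finite : IsFiniteMeasure sigma1 := by
  constructor
  have h0 : (volume : Measure ℂ).toSphere Set.univ ≠ 0 := by
    rw [Measure.measure_univ_ne_zero]
    exact Measure.toSphere_ne_zero _
  have h1 : (volume : Measure ℂ).toSphere Set.univ ≠ ⊤ := measure_ne_top _ _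
  rw [sigma1, Measure.smul_apply, smul_eq_mul, ENNReal.inv_mul_cancel h0 h1]
  exact ENNReal.one_lt_top

noncomputable def rotS (c : ℂ) (hc : ‖c‖ = 1) (ζ : sphere (0 : ℂ) 1) : sphere (0 : ℂ) 1 :=
  ⟨c * ζ.1, by simp [hc]⟩

lemma rotS_cont (c : ℂ) (hc : ‖c‖ = 1) : Continuous (rotS c hc) := by
  unfold rotS; fun_prop

open scoped Pointwise in
lemma rotS_pres (c : ℂ) (hc : ‖c‖ = 1) : MeasurePreserving (rotS c hc) sigma1 sigma1 := by
  refine ⟨(rotS_cont c hc).measurable, ?_⟩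
  have hm := (rotS_cont c hc).measurable
  rw [sigma1, Measure.map_smul]
  congr 1
  ext s hs
  rw [Measure.map_apply hm hs, Measure.toSphere_apply' _ hs, Measure.toSphere_apply' _ (hm hs)]
  congr 1
  obtain ⟨ρ, hρ⟩ : ∃ ρ : Circle, ∀ z, rotation ρ z = c * z :=
    ⟨⟨c, by simp [Submonoid.unitSphere, hc]⟩, fun z => rfl⟩
  have hpr := (rotation ρ).measurePreserving
  have hc0 : c ≠ 0 := by rintro rfl; simp at hc
  have he : (Set.Ioo (0:ℝ) 1 • Subtype.val '' (rotS c hc ⁻¹' s) : Set ℂ) =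
      (rotation ρ) ⁻¹' (Set.Ioo (0:ℝ) 1 • Subtype.val '' s) := by
    ext z
    simp only [Set.mem_smul, Set.mem_preimage, Set.mem_image, hρ]
    constructor
    · rintro ⟨r, hr, _, ⟨ζ, hζ, rfl⟩, rfl⟩
      refine ⟨r, hr, _, ⟨_, hζ, rfl⟩, ?_⟩
      simp [rotS]; ring
    · rintro ⟨r, hr, _, ⟨ζ, hζ, rfl⟩, h⟩
      refine ⟨r, hr, _, ⟨⟨c⁻¹ * ζ.1, by simp [hc]⟩, ?_, rfl⟩, ?_⟩
      · simpa [rotS, hc0] using hζ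
      · simp only at h ⊢
        have : z = c⁻¹ * (c * z) := by field_simp
        rw [this, ← h]
        simp; ring
  rw [he]
  exact (hpr.measure_preimage_equiv (f := (rotation ρ).toMeasurableEquiv) _)

lemma integral_rotS (c : ℂ) (hc : ‖c‖ = 1) (f : sphere (0 : ℂ) 1 → ℝ)
    (hf : Continuous f) :
    ∫ ζ, f (rotS c hc ζ) ∂sigma1 = ∫ ζ, f ζ ∂sigma1 := by
  have h := rotS_pres c hc
  conv_rhs => rw [← h.map_eq]
  rw [integral_map h.measurable.aemeasurable hf.aestronglyMeasurable]

noncomputable def aF (φ : ℂ → ℂ) (w : ℂ) : ℂ := w * deriv φ w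
noncomputable def bF (φ : ℂ → ℂ) (w : ℂ) : ℂ := w * deriv φ w + w ^ 2 * deriv (deriv φ) w
noncomputable def D1 (H1 : ℝ → ℝ) (φ : ℂ → ℂ) (c w : ℂ) : ℝ :=
  H1 (‖φ w‖ ^ 2) * (2 * inner ℝ (φ w) (c * aF φ w))
noncomputable def D2 (H1 H2 : ℝ → ℝ) (φ : ℂ → ℂ) (c w : ℂ) : ℝ :=
  H2 (‖φ w‖ ^ 2) * (2 * inner ℝ (φ w) (c * aF φ w)) * (2 * inner ℝ (φ w) (c * aF φ w)) +
  H1 (‖φ w‖ ^ 2) * (2 * (inner ℝ (φ w) (c * (c * bF φ w)) + inner ℝ (c * aF φ w) (c * aF φ w)))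

lemma D2_add (H1 H2 : ℝ → ℝ) (φ : ℂ → ℂ) (w : ℂ) :
    D2 H1 H2 φ 1 w + D2 H1 H2 φ Complex.I w =
      4 * ‖aF φ w‖ ^ 2 * (H1 (‖φ w‖ ^ 2) + ‖φ w‖ ^ 2 * H2 (‖φ w‖ ^ 2)) := by
  have e1 : ‖aF φ w‖ ^ 2 = (aF φ w).re ^ 2 + (aF φ w).im ^ 2 := by
    rw [← Complex.normSq_eq_norm_sq, Complex.normSq_apply]; ring
  have e2 : ‖φ w‖ ^ 2 = (φ w).re ^ 2 + (φ w).im ^ 2 := by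
    rw [← Complex.normSq_eq_norm_sq, Complex.normSq_apply]; ring
  unfold D2
  generalize H1 (‖φ w‖ ^ 2) = h1
  generalize H2 (‖φ w‖ ^ 2) = h2
  rw [e1, e2]
  simp only [Complex.inner, Complex.mul_re, Complex.mul_im, Complex.conj_re, Complex.conj_im,
    Complex.I_re, Complex.I_im, Complex.one_re, Complex.one_im]
  ring

lemma curve_deriv (w c : ℂ) (s : ℝ) :
    HasDerivAt (fun s : ℝ => w * Complex.exp (c * s)) (c * (w * Complex.exp (c * s))) s := by
  have h : HasDerivAt (fun s : ℂ => w * Complex.exp (c * s)) (w * (Complex.exp (c * s) * (c * 1))) (s : ℂ) :=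
    (((hasDerivAt_id (s : ℂ)).const_mul c).cexp).const_mul w
  convert h.comp_ofReal using 1
  ring

section
variable {φ : ℂ → ℂ} {H H1 H2 : ℝ → ℝ}

lemma D1_hasDeriv (hφ : DifferentiableOn ℂ φ (ball 0 1)) (hmaps : Set.MapsTo φ (ball 0 1) (ball 0 1))
    (hH : ∀ x ∈ Set.Ico (0:ℝ) 1, HasDerivAt H (H1 x) x)
    (w c : ℂ) (s : ℝ) (hs : w * Complex.exp (c * s) ∈ ball (0:ℂ) 1) :
    HasDerivAt (fun s : ℝ => H (‖φ (w * Complex.exp (c * s))‖ ^ 2))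
      (D1 H1 φ c (w * Complex.exp (c * s))) s := by
  have hd : HasDerivAt φ (deriv φ (w * Complex.exp (c * s))) (w * Complex.exp (c * s)) :=
    (hφ.differentiableAt (isOpen_ball.mem_nhds hs)).hasDerivAt
  have h1 := (hd.comp s (curve_deriv w c s)).norm_sq
  have hx : ‖φ (w * Complex.exp (c * s))‖ ^ 2 ∈ Set.Ico (0:ℝ) 1 := by
    have := hmaps hs
    rw [mem_ball_zero_iff] at this
    exact ⟨by positivity, by nlinarith [norm_nonneg (φ (w * Complex.exp (c * s)))]⟩
  have h2 := (hH _ hx).comp s h1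
  refine h2.congr_deriv ?_
  unfold D1 aF
  simp only [Function.comp]
  congr 3
  ring

lemma D2_hasDeriv (hφ : DifferentiableOn ℂ φ (ball 0 1)) (hmaps : Set.MapsTo φ (ball 0 1) (ball 0 1))
    (hH : ∀ x ∈ Set.Ico (0:ℝ) 1, HasDerivAt H1 (H2 x) x)
    (w c : ℂ) (s : ℝ) (hs : w * Complex.exp (c * s) ∈ ball (0:ℂ) 1) :
    HasDerivAt (fun s : ℝ => D1 H1 φ c (w * Complex.exp (c * s)))
      (D2 H1 H2 φ c (w * Complex.exp (c * s))) s := by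
  have h0 := D1_hasDeriv hφ hmaps hH w c s hs
  have hd : HasDerivAt φ (deriv φ (w * Complex.exp (c * s))) (w * Complex.exp (c * s)) :=
    (hφ.differentiableAt (isOpen_ball.mem_nhds hs)).hasDerivAt
  have hdd : HasDerivAt (deriv φ) (deriv (deriv φ) (w * Complex.exp (c * s))) (w * Complex.exp (c * s)) :=
    ((hφ.deriv isOpen_ball).differentiableAt (isOpen_ball.mem_nhds hs)).hasDerivAt
  have ha : HasDerivAt (aF φ) (1 * deriv φ (w * Complex.exp (c * s)) + (w * Complex.exp (c * s)) *
      (deriv (deriv φ) (w * Complex.exp (c * s)))) (w * Complex.exp (c * s)) :=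
    (hasDerivAt_id _).mul hdd
  have h1 := hd.comp s (curve_deriv w c s)
  have h2 := (ha.comp s (curve_deriv w c s)).const_mul c
  have h3 := ((h1.inner ℝ h2).const_mul 2)
  have h4 := h0.mul h3
  refine h4.congr_deriv ?_
  unfold D2 D1
  simp only [Function.comp]
  have e1 : (1 * deriv φ (w * Complex.exp (c * s)) + (w * Complex.exp (c * s)) *
      (deriv (deriv φ) (w * Complex.exp (c * s)))) * (c * (w * Complex.exp (c * s))) =
      c * bF φ (w * Complex.exp (c * s)) := by unfold bF; ring
  have e2 : deriv φ (w * Complex.exp (c * s)) * (c * (w * Complex.exp (c * s))) =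
      c * aF φ (w * Complex.exp (c * s)) := by unfold aF; ring
  rw [e1, e2]

lemma cont_H (hφ : DifferentiableOn ℂ φ (ball 0 1)) (hmaps : Set.MapsTo φ (ball 0 1) (ball 0 1))
    (hH : ContinuousOn H (Set.Ico 0 1)) :
    ContinuousOn (fun w => H (‖φ w‖ ^ 2)) (ball 0 1) := by
  refine hH.comp (hφ.continuousOn.norm.pow 2) ?_
  intro w hw
  have := hmaps hw
  rw [mem_ball_zero_iff] at this
  exact ⟨by positivity, by nlinarith [norm_nonneg (φ w)]⟩

lemma cont_a (hφ : DifferentiableOn ℂ φ (ball 0 1)) : ContinuousOn (aF φ) (ball 0 1) :=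
  continuousOn_id.mul (hφ.deriv isOpen_ball).continuousOn

lemma cont_b (hφ : DifferentiableOn ℂ φ (ball 0 1)) : ContinuousOn (bF φ) (ball 0 1) :=
  (cont_a hφ).add ((continuousOn_id.pow 2).mul ((hφ.deriv isOpen_ball).deriv isOpen_ball).continuousOn)

lemma cont_D1 (hφ : DifferentiableOn ℂ φ (ball 0 1)) (hmaps : Set.MapsTo φ (ball 0 1) (ball 0 1))
    (hH1 : ContinuousOn H1 (Set.Ico 0 1)) (c : ℂ) :
    ContinuousOn (D1 H1 φ c) (ball 0 1) := by
  have h1 := cont_H hφ hmaps hH1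
  have ha := cont_a hφ
  have hf := hφ.continuousOn
  exact h1.mul (continuousOn_const.mul (hf.inner (𝕜 := ℝ) (continuousOn_const.mul ha)))

lemma cont_D2 (hφ : DifferentiableOn ℂ φ (ball 0 1)) (hmaps : Set.MapsTo φ (ball 0 1) (ball 0 1))
    (hH1 : ContinuousOn H1 (Set.Ico 0 1)) (hH2 : ContinuousOn H2 (Set.Ico 0 1)) (c : ℂ) :
    ContinuousOn (D2 H1 H2 φ c) (ball 0 1) := by
  have h1 := cont_H hφ hmaps hH1
  have h2 := cont_H hφ hmaps hH2
  have ha := cont_a hφ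
  have hb := cont_b hφ
  have hf := hφ.continuousOn
  have hca : ContinuousOn (fun w => c * aF φ w) (ball 0 1) := continuousOn_const.mul ha
  have hcb : ContinuousOn (fun w => c * (c * bF φ w)) (ball 0 1) :=
    continuousOn_const.mul (continuousOn_const.mul hb)
  have h3 : ContinuousOn (fun w => 2 * inner ℝ (φ w) (c * aF φ w)) (ball 0 1) :=
    continuousOn_const.mul (hf.inner (𝕜 := ℝ) hca)
  exact ((h2.mul h3).mul h3).add
    (h1.mul (continuousOn_const.mul ((hf.inner (𝕜 := ℝ) hcb).add (hca.inner (𝕜 := ℝ) hca))))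

lemma sph_cont {f : ℂ → ℝ} (hf : ContinuousOn f (ball 0 1)) {r : ℝ} (h0 : 0 ≤ r) (hr : r < 1) :
    Continuous (fun ζ : sphere (0:ℂ) 1 => f (r * ζ.1)) := by
  refine hf.comp_continuous (by fun_prop) ?_
  intro ζ
  simp [abs_of_nonneg h0, hr]

lemma sph_int {f : sphere (0:ℂ) 1 → ℝ} (hf : Continuous f) : Integrable f sigma1 :=
  hf.integrable_of_hasCompactSupport (HasCompactSupport.of_compactSpace f)

lemma integral_D2_I (hφ : DifferentiableOn ℂ φ (ball 0 1)) (hmaps : Set.MapsTo φ (ball 0 1) (ball 0 1))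
    (hH : ∀ x ∈ Set.Ico (0:ℝ) 1, HasDerivAt H1 (H2 x) x)
    (hH2 : ContinuousOn H2 (Set.Ico 0 1)) {r : ℝ} (h0 : 0 ≤ r) (hr : r < 1) :
    ∫ ζ, D2 H1 H2 φ Complex.I (r * ζ.1) ∂sigma1 = 0 := by
  have hH1 : ContinuousOn H1 (Set.Ico 0 1) := fun x hx => (hH x hx).continuousAt.continuousWithinAt
  have hc := cont_D2 hφ hmaps hH1 hH2 Complex.I
  have hcs := sph_cont hc h0 hr
  set A := ∫ ζ, D2 H1 H2 φ Complex.I (r * ζ.1) ∂sigma1 with hA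
  have hball : ∀ (ζ : sphere (0:ℂ) 1) (θ : ℝ), (r * ζ.1) * Complex.exp (Complex.I * θ) ∈ ball (0:ℂ) 1 := by
    intro ζ θ
    have : ‖Complex.exp (Complex.I * θ)‖ = 1 := by rw [mul_comm]; exact Complex.norm_exp_ofReal_mul_I θ
    simp [abs_of_nonneg h0, hr, this]
  have h1 : ∀ θ : ℝ, ∫ ζ, D2 H1 H2 φ Complex.I ((r * ζ.1) * Complex.exp (Complex.I * θ)) ∂sigma1 = A := by
    intro θ
    have hn : ‖Complex.exp (Complex.I * θ)‖ = 1 := by rw [mul_comm]; exact Complex.norm_exp_ofReal_mul_I θ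
    rw [hA, ← integral_rotS _ hn _ hcs]
    congr 1; ext ζ; congr 1
    simp only [rotS]; ring
  have hcc : Continuous (fun q : ℝ × sphere (0:ℂ) 1 =>
      D2 H1 H2 φ Complex.I ((r * q.2.1) * Complex.exp (Complex.I * q.1))) :=
    hc.comp_continuous (by fun_prop) (fun q => hball q.2 q.1)
  have h2 : ∫ θ in Set.Ioc 0 (2 * Real.pi), ∫ ζ, D2 H1 H2 φ Complex.I ((r * ζ.1) * Complex.exp (Complex.I * θ)) ∂sigma1
      = 2 * Real.pi * A := by
    simp only [h1]
    simp [Real.pi_pos.le]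
  rw [integral_integral_swap] at h2
  · have h3 : ∀ ζ : sphere (0:ℂ) 1, ∫ θ in Set.Ioc 0 (2 * Real.pi),
        D2 H1 H2 φ Complex.I ((r * ζ.1) * Complex.exp (Complex.I * (θ:ℝ))) = 0 := by
      intro ζ
      have hpi := Real.pi_pos
      have hdd : ∀ θ ∈ Set.uIcc 0 (2 * Real.pi), HasDerivAt
          (fun s : ℝ => D1 H1 φ Complex.I ((r * ζ.1) * Complex.exp (Complex.I * s)))
          (D2 H1 H2 φ Complex.I ((r * ζ.1) * Complex.exp (Complex.I * (θ:ℝ)))) θ :=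
        fun θ _ => D2_hasDeriv hφ hmaps hH (r * ζ.1) Complex.I θ (hball ζ θ)
      rw [← intervalIntegral.integral_of_le (by positivity),
        intervalIntegral.integral_eq_sub_of_hasDerivAt hdd]
      · have : Complex.I * ((2 * Real.pi : ℝ) : ℂ) = 2 * Real.pi * Complex.I := by push_cast; ring
        rw [this, Complex.exp_two_pi_mul_I]; simp
      · apply Continuous.intervalIntegrable
        refine hc.comp_continuous (f := fun θ : ℝ => (r * ζ.1) * Complex.exp (Complex.I * (θ:ℝ))) ?_
          (fun θ => hball ζ θ)
        fun_prop
    simp only [h3, integral_zero] at h2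
    have := Real.pi_pos
    by_contra hne
    exact (mul_ne_zero (by positivity) hne) h2.symm
  · have : Integrable (fun q : ℝ × sphere (0:ℂ) 1 =>
      D2 H1 H2 φ Complex.I ((r * q.2.1) * Complex.exp (Complex.I * q.1)))
      (((volume : Measure ℝ).restrict (Set.Icc 0 (2 * Real.pi))).prod (sigma1.restrict Set.univ)) := by
      rw [Measure.prod_restrict]
      exact hcc.continuousOn.integrableOn_compact (isCompact_Icc.prod isCompact_univ)
    rw [Measure.restrict_univ, ← Measure.restrict_congr_set Ioc_ae_eq_Icc] at this
    exact this

lemma main_id (hφ : DifferentiableOn ℂ φ (ball 0 1)) (hmaps : Set.MapsTo φ (ball 0 1) (ball 0 1))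
    (hHH : ∀ x ∈ Set.Ico (0:ℝ) 1, HasDerivAt H (H1 x) x)
    (hH : ∀ x ∈ Set.Ico (0:ℝ) 1, HasDerivAt H1 (H2 x) x)
    (hH2 : ContinuousOn H2 (Set.Ico 0 1)) {u : ℝ} (h0 : -1 ≤ u) (hu : u < 0) :
    IntegrableOn (fun v => (u - v) * ∫ ζ, 4 * ‖aF φ (Real.exp v * ζ.1)‖ ^ 2 *
        (H1 (‖φ (Real.exp v * ζ.1)‖ ^ 2) + ‖φ (Real.exp v * ζ.1)‖ ^ 2 * H2 (‖φ (Real.exp v * ζ.1)‖ ^ 2)) ∂sigma1)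
        (Set.Ioc (-1) u) ∧
    ∫ ζ, H (‖φ (Real.exp u * ζ.1)‖ ^ 2) ∂sigma1 =
      ∫ ζ, H (‖φ (Real.exp (-1) * ζ.1)‖ ^ 2) ∂sigma1 + (u + 1) * ∫ ζ, D1 H1 φ 1 (Real.exp (-1) * ζ.1) ∂sigma1
      + ∫ v in Set.Ioc (-1) u, (u - v) * ∫ ζ, 4 * ‖aF φ (Real.exp v * ζ.1)‖ ^ 2 *
        (H1 (‖φ (Real.exp v * ζ.1)‖ ^ 2) + ‖φ (Real.exp v * ζ.1)‖ ^ 2 * H2 (‖φ (Real.exp v * ζ.1)‖ ^ 2)) ∂sigma1 := by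
  have hHc : ContinuousOn H (Set.Ico 0 1) := fun x hx => (hHH x hx).continuousAt.continuousWithinAt
  have hH1 : ContinuousOn H1 (Set.Ico 0 1) := fun x hx => (hH x hx).continuousAt.continuousWithinAt
  have hc := cont_D2 hφ hmaps hH1 hH2 1
  have hci := cont_D2 hφ hmaps hH1 hH2 Complex.I
  have hball : ∀ (ζ : sphere (0:ℂ) 1) (v : ℝ), v ≤ u → Real.exp v * ζ.1 ∈ ball (0:ℂ) 1 := by
    intro ζ v hv
    have : Real.exp v < 1 := by rw [Real.exp_lt_one_iff]; linarith
    rw [mem_ball_zero_iff, norm_mul]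
    simpa using this
  have hcc : ContinuousOn (fun q : ℝ × sphere (0:ℂ) 1 =>
      (u - q.1) * D2 H1 H2 φ 1 (Real.exp q.1 * q.2.1)) (Set.Icc (-1) u ×ˢ Set.univ) := by
    refine ContinuousOn.mul (by fun_prop) ?_
    refine hc.comp (Continuous.continuousOn (by fun_prop)) ?_
    intro q hq
    exact hball _ _ hq.1.2
  have hint : Integrable (fun q : ℝ × sphere (0:ℂ) 1 =>
      (u - q.1) * D2 H1 H2 φ 1 (Real.exp q.1 * q.2.1))
      (((volume : Measure ℝ).restrict (Set.Ioc (-1) u)).prod sigma1) := by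
    have : Integrable (fun q : ℝ × sphere (0:ℂ) 1 =>
      (u - q.1) * D2 H1 H2 φ 1 (Real.exp q.1 * q.2.1))
      (((volume : Measure ℝ).restrict (Set.Icc (-1) u)).prod (sigma1.restrict Set.univ)) := by
      rw [Measure.prod_restrict]
      exact hcc.integrableOn_compact (isCompact_Icc.prod isCompact_univ)
    rwa [Measure.restrict_univ, ← Measure.restrict_congr_set Ioc_ae_eq_Icc] at this
  have hinner : ∀ v ∈ Set.Ioc (-1) u, ∫ ζ : sphere (0:ℂ) 1, (u - v) * D2 H1 H2 φ 1 (Real.exp v * ζ.1) ∂sigma1 =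
      (u - v) * ∫ ζ, 4 * ‖aF φ (Real.exp v * ζ.1)‖ ^ 2 *
        (H1 (‖φ (Real.exp v * ζ.1)‖ ^ 2) + ‖φ (Real.exp v * ζ.1)‖ ^ 2 * H2 (‖φ (Real.exp v * ζ.1)‖ ^ 2)) ∂sigma1 := by
    intro v hv
    have hv1 : Real.exp v < 1 := by rw [Real.exp_lt_one_iff]; linarith [hv.2]
    rw [integral_const_mul]
    congr 1
    simp only [← D2_add]
    rw [integral_add (sph_int (sph_cont hc (Real.exp_pos v).le hv1))
      (sph_int (sph_cont hci (Real.exp_pos v).le hv1)),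
      integral_D2_I hφ hmaps hH hH2 (Real.exp_pos v).le hv1, add_zero]
  have hI := hint.integral_prod_left
  have hI' := (integrableOn_congr_fun hinner measurableSet_Ioc).1 hI
  refine ⟨hI', ?_⟩
  rw [← setIntegral_congr_fun measurableSet_Ioc hinner, integral_integral_swap hint]
  have hu1 : Real.exp u < 1 := by rw [Real.exp_lt_one_iff]; linarith
  have hm1 : Real.exp (-1) < 1 := by rw [Real.exp_lt_one_iff]; linarith
  have hpt : ∀ ζ : sphere (0:ℂ) 1, ∫ v in Set.Ioc (-1) u, (u - v) * D2 H1 H2 φ 1 (Real.exp v * ζ.1) =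
      H (‖φ (Real.exp u * ζ.1)‖ ^ 2) - H (‖φ (Real.exp (-1) * ζ.1)‖ ^ 2)
        - (u + 1) * D1 H1 φ 1 (Real.exp (-1) * ζ.1) := by
    intro ζ
    have hb : ∀ v : ℝ, (Real.exp v : ℂ) * ζ.1 = ζ.1 * Complex.exp (1 * v) := by
      intro v; rw [one_mul, mul_comm, Complex.ofReal_exp]
    have hd : ∀ v ∈ Set.uIcc (-1) u, HasDerivAt (fun v : ℝ => H (‖φ (Real.exp v * ζ.1)‖ ^ 2) +
        (u - v) * D1 H1 φ 1 (Real.exp v * ζ.1)) ((u - v) * D2 H1 H2 φ 1 (Real.exp v * ζ.1)) v := by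
      intro v hv
      rw [Set.uIcc_of_le h0] at hv
      have hbb := hball ζ v hv.2
      simp only [hb] at hbb ⊢
      have e1 := D1_hasDeriv hφ hmaps hHH ζ.1 1 v hbb
      have e2 := D2_hasDeriv hφ hmaps hH ζ.1 1 v hbb
      have e3 : HasDerivAt (fun v : ℝ => u - v) (-1) v := by
        simpa using (hasDerivAt_id v).const_sub u
      refine (e1.add (e3.mul e2)).congr_deriv ?_
      ring
    rw [← intervalIntegral.integral_of_le h0, intervalIntegral.integral_eq_sub_of_hasDerivAt hd]
    · ring
    · apply ContinuousOn.intervalIntegrable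
      rw [Set.uIcc_of_le h0]
      exact hcc.comp (f := fun v : ℝ => (v, ζ)) (Continuous.continuousOn (by fun_prop)) (fun v hv => ⟨hv, trivial⟩)
  simp only [hpt]
  have i1 := sph_int (sph_cont (cont_H hφ hmaps hHc) (Real.exp_pos u).le hu1)
  have i2 := sph_int (sph_cont (cont_H hφ hmaps hHc) (Real.exp_pos (-1)).le hm1)
  have i3 := sph_int (sph_cont (cont_D1 hφ hmaps hH1 1) (Real.exp_pos (-1)).le hm1)
  have i12 : Integrable (fun ζ : sphere (0:ℂ) 1 => H (‖φ (Real.exp u * ζ.1)‖ ^ 2) -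
    H (‖φ (Real.exp (-1) * ζ.1)‖ ^ 2)) sigma1 := i1.sub i2
  rw [integral_sub i12 (i3.const_mul _), integral_sub i1 i2, integral_const_mul]
  ring

end

lemma ftc_aux {k : ℝ → ℝ} (hk : ContinuousOn k (Set.Ioi 0)) {T : ℝ} (hT : 0 < T) :
    HasDerivAt (fun T => ∫ u in (1:ℝ)..T, k u) (k T) T := by
  apply intervalIntegral.integral_hasDerivAt_right
  · apply ContinuousOn.intervalIntegrable
    apply hk.mono
    intro x hx
    have : min 1 T ≤ x := hx.1
    exact lt_of_lt_of_le (lt_min one_pos hT) this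
  · exact hk.stronglyMeasurableAtFilter isOpen_Ioi T hT
  · exact hk.continuousAt (isOpen_Ioi.mem_nhds hT)

lemma Omega_cont {Ω : ℝ → ℝ} {ε : ℝ}
    (hΩmono : MonotoneOn Ω (Set.Ioc (0 : ℝ) 1))
    (hreg : AntitoneOn (fun t : ℝ => Ω t / t ^ ((1 : ℝ) - ε)) (Set.Ioc (0 : ℝ) 1)) :
    ContinuousOn Ω (Set.Ioc 0 1) := by
  intro t ht
  have hpt : 0 < t ^ ((1:ℝ) - ε) := Real.rpow_pos_of_pos ht.1 _
  have hc : ContinuousWithinAt (fun s : ℝ => Ω t / t ^ ((1:ℝ) - ε) * s ^ ((1:ℝ) - ε)) (Set.Ioc 0 1) t :=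
    (continuousAt_const.mul (Real.continuousAt_rpow_const _ _ (Or.inl ht.1.ne'))).continuousWithinAt
  have he : Ω t / t ^ ((1:ℝ) - ε) * t ^ ((1:ℝ) - ε) = Ω t := by field_simp
  have h1 := (continuousWithinAt_const (b := Ω t) (x := t) (s := Set.Ioc (0:ℝ) 1)).min hc
  have h2 := (continuousWithinAt_const (b := Ω t) (x := t) (s := Set.Ioc (0:ℝ) 1)).max hc
  have h1' := h1
  have h2' := h2
  simp only [he, min_self, max_self] at h1' h2'
  refine tendsto_of_tendsto_of_tendsto_of_le_of_le' h1' h2' ?_ ?_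
  · filter_upwards [self_mem_nhdsWithin] with s hs
    have hps : 0 < s ^ ((1:ℝ) - ε) := Real.rpow_pos_of_pos hs.1 _
    rcases le_total t s with h | h
    · exact (min_le_left _ _).trans (hΩmono ht hs h)
    · have := hreg hs ht h
      simp only at this
      refine (min_le_right _ _).trans ?_
      rwa [le_div_iff₀ hps] at this
  · filter_upwards [self_mem_nhdsWithin] with s hs
    have hps : 0 < s ^ ((1:ℝ) - ε) := Real.rpow_pos_of_pos hs.1 _
    rcases le_total t s with h | h
    · have := hreg ht hs h
      simp only at this
      refine le_trans ?_ (le_max_right _ _)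
      rwa [div_le_iff₀ hps] at this
    · exact (hΩmono hs ht h).trans (le_max_left _ _)

lemma real_side (Ω : ℝ → ℝ)
    (hΩpos : ∀ t ∈ Set.Ioc (0 : ℝ) 1, 0 < Ω t)
    (hΩmono : MonotoneOn Ω (Set.Ioc (0 : ℝ) 1)) (ε : ℝ) (hε : 0 < ε)
    (hreg : AntitoneOn (fun t : ℝ => Ω t / t ^ ((1 : ℝ) - ε)) (Set.Ioc (0 : ℝ) 1))
    (p : ℝ) (hp : 1 ≤ p) :
    ∃ G H1 H2 : ℝ → ℝ, ∃ C : ℝ, 0 < C ∧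
      (∀ x ∈ Set.Ico (0:ℝ) 1, HasDerivAt (fun x => G x ^ p) (H1 x) x) ∧
      (∀ x ∈ Set.Ico (0:ℝ) 1, HasDerivAt H1 (H2 x) x) ∧
      ContinuousOn H2 (Set.Ico 0 1) ∧ ContinuousOn G (Set.Ico 0 1) ∧
      (∀ x ∈ Set.Ico (0:ℝ) 1, 1 ≤ G x) ∧
      (∀ s ∈ Set.Ico (0:ℝ) 1, Phi Ω (1 - s) ≤ C * G (s ^ 2)) ∧
      (∀ s ∈ Set.Ico (0:ℝ) 1, H1 (s ^ 2) + s ^ 2 * H2 (s ^ 2) ≤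
        C * (G (s ^ 2) ^ (p - 1) * (Ω (1 - s) / (1 - s)) ^ 2)) := by
  have hΩc := Omega_cont hΩmono hreg
  have h1mem : (1:ℝ) ∈ Set.Ioc (0:ℝ) 1 := ⟨one_pos, le_rfl⟩
  have hΩ1 := hΩpos 1 h1mem
  -- Ω / t is antitone
  have hanti : ∀ t ∈ Set.Ioc (0:ℝ) 1, ∀ T ∈ Set.Ioc (0:ℝ) 1, t ≤ T → Ω T / T ≤ Ω t / t := by
    intro t ht T hT htT
    have e : ∀ t ∈ Set.Ioc (0:ℝ) 1, Ω t / t = Ω t / t ^ ((1:ℝ) - ε) * t ^ (-ε) := by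
      intro t ht
      have : t ^ ((1:ℝ) - ε) = t * t ^ (-ε) := by
        rw [sub_eq_add_neg, Real.rpow_add ht.1, Real.rpow_one]
      have h0 : 0 < t ^ (-ε) := Real.rpow_pos_of_pos ht.1 _
      have := ht.1
      rw [‹t ^ ((1:ℝ) - ε) = _›]
      field_simp
    rw [e t ht, e T hT]
    have h2 : T ^ (-ε) ≤ t ^ (-ε) := Real.rpow_le_rpow_of_nonpos ht.1 htT (by linarith)
    exact mul_le_mul (hreg ht hT htT) h2 (Real.rpow_pos_of_pos hT.1 _).le
      (div_pos (hΩpos t ht) (Real.rpow_pos_of_pos ht.1 _)).le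
  obtain ⟨Ωe, hΩe⟩ : ∃ Ωe : ℝ → ℝ, Ωe = fun t => Ω (min t 1) := ⟨_, rfl⟩
  have hΩec : ContinuousOn Ωe (Set.Ioi 0) := by
    rw [hΩe]
    refine hΩc.comp (Continuous.continuousOn (by fun_prop)) ?_
    intro t ht
    exact ⟨lt_min ht one_pos, min_le_right _ _⟩
  have hΩeq : ∀ t ∈ Set.Ioc (0:ℝ) 1, Ωe t = Ω t := by
    intro t ht; rw [hΩe]; simp [min_eq_left ht.2]
  obtain ⟨k, hk⟩ : ∃ k : ℝ → ℝ, k = fun u => Ωe u ^ 2 / u ^ 2 := ⟨_, rfl⟩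
  have hkc : ContinuousOn k (Set.Ioi 0) := by
    rw [hk]
    exact (hΩec.pow 2).div (continuousOn_id.pow 2) (fun x hx => pow_ne_zero _ (ne_of_gt hx))
  obtain ⟨J, hJ⟩ : ∃ J : ℝ → ℝ, J = fun T => Ω 1 ^ 2 - ∫ u in (1:ℝ)..T, k u := ⟨_, rfl⟩
  have hJd : ∀ T, 0 < T → HasDerivAt J (- k T) T := by
    intro T hT; rw [hJ]; exact (ftc_aux hkc hT).const_sub _
  have hJc : ContinuousOn J (Set.Ioi 0) := fun T hT => (hJd T hT).continuousAt.continuousWithinAt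
  obtain ⟨G, hG⟩ : ∃ G : ℝ → ℝ, G = fun x => 1 - ∫ u in (1:ℝ)..(1 - x), J u := ⟨_, rfl⟩
  have hsub : ∀ x : ℝ, HasDerivAt (fun x : ℝ => 1 - x) (-1) x := fun x => by
    simpa using (hasDerivAt_id x).const_sub 1
  have hGd : ∀ x, x < 1 → HasDerivAt G (J (1 - x)) x := by
    intro x hx; rw [hG]
    have h := ((ftc_aux hJc (sub_pos.2 hx)).comp x (hsub x)).const_sub 1
    exact h.congr_deriv (by ring)
  have hJd' : ∀ x, x < 1 → HasDerivAt (fun x => J (1 - x)) (k (1 - x)) x := by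
    intro x hx
    exact ((hJd _ (sub_pos.2 hx)).comp x (hsub x)).congr_deriv (by ring)
  have hGc : ContinuousOn G (Set.Ico 0 1) := fun x hx => (hGd x hx.2).continuousAt.continuousWithinAt
  have hII : ∀ {f : ℝ → ℝ}, ContinuousOn f (Set.Ioi 0) → ∀ {a b : ℝ}, 0 < a → 0 < b →
      IntervalIntegrable f volume a b := by
    intro f hf a b ha hb
    apply ContinuousOn.intervalIntegrable
    apply hf.mono
    intro x hx
    exact lt_of_lt_of_le (lt_min ha hb) hx.1
  -- lower bound of J
  have hJlow : ∀ T ∈ Set.Ioc (0:ℝ) 1, Ω T ^ 2 / T ≤ J T := by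
    intro T hT
    have h1 : ∫ u in T..1, Ω T ^ 2 * (u ^ 2)⁻¹ = Ω T ^ 2 * (T⁻¹ - 1) := by
      rw [intervalIntegral.integral_const_mul]
      congr 1
      rw [intervalIntegral.integral_eq_sub_of_hasDerivAt (f := fun u => - u⁻¹)]
      · simp; ring
      · intro u hu
        rw [Set.uIcc_of_le hT.2] at hu
        have : u ≠ 0 := (lt_of_lt_of_le hT.1 hu.1).ne'
        exact ((hasDerivAt_inv this).fun_neg).congr_deriv (by simp)
      · apply hII _ hT.1 one_pos
        exact (continuousOn_id.pow 2).inv₀ (fun x hx => pow_ne_zero _ (ne_of_gt hx))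
    have h2 : ∫ u in T..1, Ω T ^ 2 * (u ^ 2)⁻¹ ≤ ∫ u in T..1, k u := by
      apply intervalIntegral.integral_mono_on hT.2
      · apply hII _ hT.1 one_pos
        exact continuousOn_const.mul ((continuousOn_id.pow 2).inv₀ (fun x hx => pow_ne_zero _ (ne_of_gt hx)))
      · exact hII hkc hT.1 one_pos
      · intro u hu
        have hu' : u ∈ Set.Ioc (0:ℝ) 1 := ⟨lt_of_lt_of_le hT.1 hu.1, hu.2⟩
        rw [hk]; simp only [hΩeq u hu', div_eq_mul_inv]
        have := hΩmono hT hu' hu.1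
        have := hΩpos T hT
        gcongr
    have h3 : Ω T ^ 2 ≤ Ω 1 ^ 2 := by
      have := hΩmono hT h1mem hT.2
      have := hΩpos T hT
      gcongr
    rw [hJ]; simp only
    rw [intervalIntegral.integral_symm, div_eq_mul_inv]
    linarith
  have hJpos : ∀ T ∈ Set.Ioc (0:ℝ) 1, 0 ≤ J T := fun T hT =>
    le_trans (div_nonneg (sq_nonneg _) hT.1.le) (hJlow T hT)
  -- upper bound of J
  have hJup : ∀ T ∈ Set.Ioc (0:ℝ) 1, J T ≤ Ω 1 * (1 + 1 / ε) * (Ω T / T) := by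
    intro T hT
    have hT0 := hT.1
    have hΩT := hΩpos T hT
    have hpow : T ^ ((1:ℝ) - ε) = T * T ^ (-ε) := by
      rw [sub_eq_add_neg, Real.rpow_add hT.1, Real.rpow_one]
    have hTe : 0 < T ^ (-ε) := Real.rpow_pos_of_pos hT.1 _
    have hc : ContinuousOn (fun u : ℝ => Ω T / T ^ ((1:ℝ) - ε) * Ω 1 * u ^ (-1 - ε)) (Set.Ioi 0) := by
      apply continuousOn_const.mul
      exact continuousOn_id.rpow_const (fun x hx => Or.inl (ne_of_gt hx))
    have h2 : ∫ u in T..1, k u ≤ ∫ u in T..1, Ω T / T ^ ((1:ℝ) - ε) * Ω 1 * u ^ (-1 - ε) := by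
      apply intervalIntegral.integral_mono_on hT.2
      · exact hII hkc hT.1 one_pos
      · exact hII hc hT.1 one_pos
      · intro u hu
        have hu0 : 0 < u := lt_of_lt_of_le hT.1 hu.1
        have hu' : u ∈ Set.Ioc (0:ℝ) 1 := ⟨hu0, hu.2⟩
        rw [hk]; simp only [hΩeq u hu']
        have e1 := hreg hT hu' hu.1
        simp only at e1
        have e2 := hΩmono hu' h1mem hu.2
        have e3 := hΩpos u hu'
        have hpu : 0 < u ^ ((1:ℝ) - ε) := Real.rpow_pos_of_pos hu0 _
        have e4 : u ^ (-1 - ε) = u ^ ((1:ℝ) - ε) / u ^ 2 := by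
          rw [← Real.rpow_natCast u 2, ← Real.rpow_sub hu0]; congr 1; push_cast; ring
        have e5 : Ω u ^ 2 / u ^ 2 = Ω u / u ^ ((1:ℝ) - ε) * Ω u * u ^ (-1 - ε) := by
          rw [e4]; field_simp
        rw [e5]
        have : 0 < u ^ (-1 - ε) := Real.rpow_pos_of_pos hu0 _
        gcongr
    have h3 : ∫ u in T..1, Ω T / T ^ ((1:ℝ) - ε) * Ω 1 * u ^ (-1 - ε) ≤ Ω T / T ^ ((1:ℝ) - ε) * Ω 1 * (T ^ (-ε) / ε) := by
      rw [intervalIntegral.integral_const_mul]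
      have hn : (0:ℝ) ∉ Set.uIcc T 1 := by
        rw [Set.uIcc_of_le hT.2]; intro h; linarith [h.1]
      rw [integral_rpow (Or.inr ⟨by linarith, hn⟩)]
      have : (-1 - ε + 1) = -ε := by ring
      rw [this, Real.one_rpow]
      have : (1 - T ^ (-ε)) / (-ε) ≤ T ^ (-ε) / ε := by
        rw [div_neg, ← neg_div, div_le_div_iff_of_pos_right hε]; linarith
      have : 0 ≤ Ω T / T ^ ((1:ℝ) - ε) * Ω 1 := by positivity
      gcongr
    have h4 : Ω T / T ^ ((1:ℝ) - ε) * Ω 1 * (T ^ (-ε) / ε) = Ω 1 * (1 / ε) * (Ω T / T) := by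
      rw [hpow]; field_simp
    have h5 : Ω 1 ≤ Ω T / T := by simpa using hanti T hT 1 h1mem hT.2
    have hJT : J T = Ω 1 ^ 2 + ∫ u in T..1, k u := by
      rw [hJ]; simp only; rw [intervalIntegral.integral_symm]; ring
    rw [hJT]
    nlinarith
  have hGeq : ∀ x, G x = 1 + ∫ u in (1 - x)..1, J u := by
    intro x
    rw [hG]; simp only; rw [intervalIntegral.integral_symm]; ring
  have hG1 : ∀ x ∈ Set.Ico (0:ℝ) 1, 1 ≤ G x := by
    intro x hx
    rw [hGeq]
    have : 0 ≤ ∫ u in (1 - x)..1, J u := by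
      apply intervalIntegral.integral_nonneg (by linarith [hx.1])
      intro u hu
      exact hJpos u ⟨by linarith [hx.2, hu.1], hu.2⟩
    linarith
  obtain ⟨C1, hC1⟩ : ∃ C1, C1 = Ω 1 * (1 + 1 / ε) := ⟨_, rfl⟩
  have hC1pos : 0 < C1 := by rw [hC1]; positivity
  refine ⟨G, fun x => J (1 - x) * p * G x ^ (p - 1),
    fun x => (k (1 - x) * p) * G x ^ (p - 1) + J (1 - x) * p * (J (1 - x) * (p - 1) * G x ^ (p - 1 - 1)),
    (1 + Ω 1 ^ 2) + p * (C1 / Ω 1 + (p - 1) * C1 ^ 2 + 1), ?_, ?_, ?_, ?_, hGc, hG1, ?_, ?_⟩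
  · have : 0 ≤ p - 1 := by linarith
    positivity
  · intro x hx
    have := hG1 x hx
    exact (hGd x hx.2).rpow_const (Or.inl (by linarith))
  · intro x hx
    have := hG1 x hx
    exact ((hJd' x hx.2).mul_const p).mul ((hGd x hx.2).rpow_const (Or.inl (by linarith)))
  · have c1 : ContinuousOn (fun x : ℝ => J (1 - x)) (Set.Ico 0 1) :=
      hJc.comp (Continuous.continuousOn (by fun_prop)) (fun x hx => sub_pos.2 hx.2)
    have c2 : ContinuousOn (fun x : ℝ => k (1 - x)) (Set.Ico 0 1) :=
      hkc.comp (Continuous.continuousOn (by fun_prop)) (fun x hx => sub_pos.2 hx.2)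
    have c3 : ∀ q : ℝ, ContinuousOn (fun x : ℝ => G x ^ q) (Set.Ico 0 1) := fun q =>
      hGc.rpow_const (fun x hx => Or.inl (by have := hG1 x hx; linarith))
    exact ((c2.mul continuousOn_const).mul (c3 _)).add
      ((c1.mul continuousOn_const).mul ((c1.mul continuousOn_const).mul (c3 _)))
  · intro s hs
    have hs0 := hs.1
    have hs1 := hs.2
    have ht : (1 - s) ∈ Set.Ioc (0:ℝ) 1 := ⟨by linarith, by linarith⟩
    have hx : s ^ 2 ∈ Set.Ico (0:ℝ) 1 := ⟨by positivity, by nlinarith⟩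
    have hT : (1 - s ^ 2) ∈ Set.Ioc (0:ℝ) 1 := ⟨by linarith [hx.2], by linarith [hx.1]⟩
    have htT : 1 - s ≤ 1 - s ^ 2 := by nlinarith
    obtain ⟨f, hf⟩ : ∃ f : ℝ → ℝ, f = fun u => Ωe u ^ 2 / u := ⟨_, rfl⟩
    have hfc : ContinuousOn f (Set.Ioi 0) := by
      rw [hf]
      exact (hΩec.pow 2).div continuousOn_id (fun x hx => ne_of_gt hx)
    have hPhi : Phi Ω (1 - s) = 1 + ∫ u in (1 - s)..1, f u := by
      unfold Phi
      rw [intervalIntegral.integral_of_le ht.2]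
      congr 1
      apply setIntegral_congr_fun measurableSet_Ioc
      intro u hu
      rw [hf]; simp only
      rw [hΩeq u ⟨lt_trans ht.1 hu.1, hu.2⟩]
    rw [← intervalIntegral.integral_add_adjacent_intervals (hII hfc ht.1 hT.1) (hII hfc hT.1 one_pos)] at hPhi
    have b1 : ∫ u in (1 - s)..(1 - s ^ 2), f u ≤ Ω 1 ^ 2 := by
      have : ∫ u in (1 - s)..(1 - s ^ 2), f u ≤ ∫ u in (1 - s)..(1 - s ^ 2), Ω 1 ^ 2 / (1 - s) := by
        apply intervalIntegral.integral_mono_on htT (hII hfc ht.1 hT.1)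
        · simp
        · intro u hu
          have hu' : u ∈ Set.Ioc (0:ℝ) 1 := ⟨lt_of_lt_of_le ht.1 hu.1, hu.2.trans hT.2⟩
          rw [hf]; simp only
          rw [hΩeq u hu']
          have e1 := hΩpos u hu'
          have e2 := hΩmono hu' h1mem hu'.2
          have e3 := ht.1
          have e4 := hu.1
          gcongr
      refine this.trans ?_
      rw [intervalIntegral.integral_const, smul_eq_mul]
      have e : (1 - s ^ 2 - (1 - s)) * (Ω 1 ^ 2 / (1 - s)) = s * Ω 1 ^ 2 := by
        have := ht.1.ne'
        field_simp
        ring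
      rw [e]
      nlinarith [sq_nonneg (Ω 1)]
    have b2 : ∫ u in (1 - s ^ 2)..1, f u ≤ ∫ u in (1 - s ^ 2)..1, J u := by
      apply intervalIntegral.integral_mono_on hT.2 (hII hfc hT.1 one_pos) (hII hJc hT.1 one_pos)
      intro u hu
      have hu' : u ∈ Set.Ioc (0:ℝ) 1 := ⟨lt_of_lt_of_le hT.1 hu.1, hu.2⟩
      rw [hf]; simp only
      rw [hΩeq u hu']
      exact hJlow u hu'
    have b3 := hG1 _ hx
    have b4 := hGeq (s ^ 2)
    have b5 : 0 ≤ p * (C1 / Ω 1 + (p - 1) * C1 ^ 2 + 1) := by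
      have : 0 ≤ p - 1 := by linarith
      positivity
    rw [hPhi]
    nlinarith [sq_nonneg (Ω 1), mul_nonneg b5 (by linarith : 0 ≤ G (s ^ 2)),
      mul_nonneg (sq_nonneg (Ω 1)) (by linarith : 0 ≤ G (s ^ 2) - 1)]
  · intro s hs
    have hs0 := hs.1
    have hs1 := hs.2
    have ht : (1 - s) ∈ Set.Ioc (0:ℝ) 1 := ⟨by linarith, by linarith⟩
    have hx : s ^ 2 ∈ Set.Ico (0:ℝ) 1 := ⟨by positivity, by nlinarith⟩
    have hT : (1 - s ^ 2) ∈ Set.Ioc (0:ℝ) 1 := ⟨by linarith [hx.2], by linarith [hx.1]⟩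
    have htT : 1 - s ≤ 1 - s ^ 2 := by nlinarith
    have q0 := hanti _ ht _ hT htT
    have q1 : Ω 1 ≤ Ω (1 - s) / (1 - s) := by simpa using hanti _ ht 1 h1mem ht.2
    have q2 := hJup _ hT
    rw [← hC1] at q2
    have q3 := hJpos _ hT
    have q4 : k (1 - s ^ 2) ≤ (Ω (1 - s) / (1 - s)) ^ 2 := by
      rw [hk]; simp only
      rw [hΩeq _ hT, ← div_pow]
      have := div_pos (hΩpos _ hT) hT.1
      gcongr
    have q5 : 0 ≤ k (1 - s ^ 2) := by rw [hk]; positivity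
    beta_reduce
    generalize Ω (1 - s) / (1 - s) = q at q0 q1 q4 ⊢
    have hq : 0 < q := lt_of_lt_of_le hΩ1 q1
    have hGx := hG1 _ hx
    generalize hg : G (s ^ 2) = g at hGx ⊢
    generalize J (1 - s ^ 2) = j at q2 q3 ⊢
    generalize k (1 - s ^ 2) = κ at q4 q5 ⊢
    have j1 : j ≤ C1 * q := q2.trans (by gcongr)
    have j2 : j ≤ C1 / Ω 1 * q ^ 2 := by
      refine j1.trans ?_
      have : C1 / Ω 1 * q ^ 2 = C1 * q * (q / Ω 1) := by ring
      rw [this]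
      have : 1 ≤ q / Ω 1 := by rwa [one_le_div hΩ1]
      nlinarith [mul_pos hC1pos hq]
    have j3 : j * j ≤ C1 ^ 2 * q ^ 2 := by nlinarith
    have g1 : g ^ (p - 1 - 1) ≤ g ^ (p - 1) := Real.rpow_le_rpow_of_exponent_le hGx (by linarith)
    have g2 : 0 < g ^ (p - 1 - 1) := Real.rpow_pos_of_pos (by linarith) _
    have g3 : 0 < g ^ (p - 1) := Real.rpow_pos_of_pos (by linarith) _
    have hp1 : 0 ≤ p - 1 := by linarith
    have t1 : j * p * g ^ (p - 1) ≤ (C1 / Ω 1 * q ^ 2) * p * g ^ (p - 1) := by gcongr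
    have t2 : κ * p * g ^ (p - 1) ≤ q ^ 2 * p * g ^ (p - 1) := by gcongr
    have t3 : j * p * (j * (p - 1) * g ^ (p - 1 - 1)) ≤ (C1 ^ 2 * q ^ 2) * (p * (p - 1)) * g ^ (p - 1) := by
      calc _ = (j * j) * (p * (p - 1)) * g ^ (p - 1 - 1) := by ring
        _ ≤ _ := by gcongr
    have t4 : 0 ≤ κ * p * g ^ (p - 1) + j * p * (j * (p - 1) * g ^ (p - 1 - 1)) := by positivity
    have t5 : s ^ 2 * (κ * p * g ^ (p - 1) + j * p * (j * (p - 1) * g ^ (p - 1 - 1))) ≤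
        κ * p * g ^ (p - 1) + j * p * (j * (p - 1) * g ^ (p - 1 - 1)) := by
      nlinarith [hx.2]
    have t6 : 0 ≤ (1 + Ω 1 ^ 2) * (g ^ (p - 1) * q ^ 2) := by positivity
    calc _ ≤ (C1 / Ω 1 * q ^ 2) * p * g ^ (p - 1) + (q ^ 2 * p * g ^ (p - 1) +
          (C1 ^ 2 * q ^ 2) * (p * (p - 1)) * g ^ (p - 1)) := by linarith
      _ ≤ (C1 / Ω 1 * q ^ 2) * p * g ^ (p - 1) + (q ^ 2 * p * g ^ (p - 1) +
          (C1 ^ 2 * q ^ 2) * (p * (p - 1)) * g ^ (p - 1)) + (1 + Ω 1 ^ 2) * (g ^ (p - 1) * q ^ 2) := by linarith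
      _ = _ := by ring

lemma sph_holder {F K : sphere (0:ℂ) 1 → ℝ} (hF : Continuous F) (hK : Continuous K)
    (hF0 : ∀ ζ, 0 ≤ F ζ) (hK0 : ∀ ζ, 0 ≤ K ζ) {a b : ℝ} (ha : 0 ≤ a) (hb : 0 ≤ b) (hab : a + b = 1) :
    ∫ ζ, F ζ ^ a * K ζ ^ b ∂sigma1 ≤ (∫ ζ, F ζ ∂sigma1) ^ a * (∫ ζ, K ζ ∂sigma1) ^ b := by
  have hc : Continuous (fun ζ => F ζ ^ a * K ζ ^ b) :=
    (hF.rpow_const (fun _ => Or.inr ha)).mul (hK.rpow_const (fun _ => Or.inr hb))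
  have IF : 0 ≤ ∫ ζ, F ζ ∂sigma1 := integral_nonneg hF0
  have IK : 0 ≤ ∫ ζ, K ζ ∂sigma1 := integral_nonneg hK0
  have h := ENNReal.lintegral_mul_norm_pow_le (μ := sigma1)
    (f := fun ζ => ENNReal.ofReal (F ζ)) (g := fun ζ => ENNReal.ofReal (K ζ))
    hF.measurable.ennreal_ofReal.aemeasurable hK.measurable.ennreal_ofReal.aemeasurable ha hb hab
  rw [← ofReal_integral_eq_lintegral_ofReal (sph_int hF) (Eventually.of_forall hF0),
    ← ofReal_integral_eq_lintegral_ofReal (sph_int hK) (Eventually.of_forall hK0),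
    ENNReal.ofReal_rpow_of_nonneg IF ha, ENNReal.ofReal_rpow_of_nonneg IK hb,
    ← ENNReal.ofReal_mul (Real.rpow_nonneg IF a)] at h
  have e : ∀ ζ, ENNReal.ofReal (F ζ) ^ a * ENNReal.ofReal (K ζ) ^ b = ENNReal.ofReal (F ζ ^ a * K ζ ^ b) := by
    intro ζ
    rw [ENNReal.ofReal_rpow_of_nonneg (hF0 ζ) ha, ENNReal.ofReal_rpow_of_nonneg (hK0 ζ) hb,
      ← ENNReal.ofReal_mul (Real.rpow_nonneg (hF0 ζ) a)]
  simp only [e] at h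
  rw [← ofReal_integral_eq_lintegral_ofReal (sph_int hc)
    (Eventually.of_forall fun ζ => mul_nonneg (Real.rpow_nonneg (hF0 ζ) a) (Real.rpow_nonneg (hK0 ζ) b))] at h
  exact (ENNReal.ofReal_le_ofReal_iff (mul_nonneg (Real.rpow_nonneg IF a) (Real.rpow_nonneg IK b))).1 h

lemma weight_int (ω : ℝ → ℝ) (hωmono : MonotoneOn ω (Set.Ioc (0 : ℝ) 1))
    (hωint : ∫⁻ t in Set.Ioc (0 : ℝ) 1, ENNReal.ofReal (ω t ^ 2 / t) < ⊤) :
    IntegrableOn (fun v => Real.exp v * (ω (1 - Real.exp v) ^ 2 / (1 - Real.exp v))) (Set.Ioo (-1) 0) := by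
  have h1 : IntegrableOn (fun t => ω t ^ 2 / t) (Set.Ioc 0 1) := by
    refine ⟨?_, ?_⟩
    · have := aemeasurable_restrict_of_monotoneOn (μ := volume) measurableSet_Ioc hωmono
      exact ((this.pow_const 2).div aemeasurable_id).aestronglyMeasurable
    · rw [hasFiniteIntegral_iff_ofReal]
      · exact hωint
      · filter_upwards [ae_restrict_mem measurableSet_Ioc] with t ht
        exact div_nonneg (sq_nonneg _) ht.1.le
  have h2 : IntegrableOn (fun t => ω t ^ 2 / t) ((fun v => 1 - Real.exp v) '' Set.Ioo (-1) 0) := by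
    apply h1.mono_set
    rintro _ ⟨v, hv, rfl⟩
    have e1 : Real.exp v < 1 := by rw [Real.exp_lt_one_iff]; exact hv.2
    have := Real.exp_pos v
    constructor <;> simp only <;> linarith
  rw [integrableOn_image_iff_integrableOn_abs_deriv_smul (f' := fun v => - Real.exp v) measurableSet_Ioo] at h2
  · refine h2.congr_fun ?_ measurableSet_Ioo
    intro v _
    simp
  · intro v _
    exact ((Real.hasDerivAt_exp v).const_sub 1).hasDerivWithinAt
  · intro x _ y _ h
    simpa using h

lemma absorb {A K B p : ℝ} (hp : 1 ≤ p) (hK : 0 ≤ K) (hB : 0 ≤ B)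
    (h : A ≤ K + B * A ^ (1 - 1 / p)) : A ≤ max 1 ((K + B) ^ p) := by
  rcases le_or_gt A 1 with h1 | h1
  · exact le_max_of_le_left h1
  · apply le_max_of_le_right
    have hp0 : 0 < p := by linarith
    have hA : 0 < A := by linarith
    have h2 : 1 ≤ A ^ (1 - 1 / p) := Real.one_le_rpow h1.le (by
      rw [sub_nonneg, div_le_one hp0]; exact hp)
    have h3 : A = A ^ (1 / p) * A ^ (1 - 1 / p) := by
      rw [← Real.rpow_add hA]; simp
    have h4 : A ^ (1 / p) * A ^ (1 - 1 / p) ≤ (K + B) * A ^ (1 - 1 / p) := by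
      rw [← h3]; nlinarith
    have h5 : A ^ (1 / p) ≤ K + B := le_of_mul_le_mul_right h4 (by linarith)
    have h6 := Real.rpow_le_rpow (Real.rpow_nonneg hA.le _) h5 hp0.le
    rwa [← Real.rpow_mul hA.le, one_div_mul_cancel hp0.ne', Real.rpow_one] at h6

lemma sph_bdd {f : ℂ → ℝ} (hf : ContinuousOn f (ball 0 1)) {r0 : ℝ} (hr0 : r0 < 1) :
    ∃ M : ℝ, ∀ r : ℝ, 0 ≤ r → r ≤ r0 → ∫ ζ : sphere (0:ℂ) 1, f (r * ζ.1) ∂sigma1 ≤ M := by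
  obtain ⟨M, hM⟩ := (isCompact_closedBall (0:ℂ) r0).exists_bound_of_continuousOn
    (hf.mono (closedBall_subset_ball hr0))
  refine ⟨∫ ζ : sphere (0:ℂ) 1, M ∂sigma1, fun r h0 hr => ?_⟩
  apply integral_mono (sph_int (sph_cont hf h0 (by linarith))) (sph_int continuous_const)
  intro ζ
  refine (le_abs_self _).trans (hM _ ?_)
  simp [abs_of_nonneg h0, hr]

lemma unif_bound (ω Ω : ℝ → ℝ)
    (hωmono : MonotoneOn ω (Set.Ioc (0 : ℝ) 1))
    (hωint : ∫⁻ t in Set.Ioc (0 : ℝ) 1, ENNReal.ofReal (ω t ^ 2 / t) < ⊤)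
    (hΩc : ContinuousOn Ω (Set.Ioc 0 1)) (hΩpos : ∀ t ∈ Set.Ioc (0 : ℝ) 1, 0 < Ω t)
    (p : ℝ) (hp : 1 ≤ p) (φ : ℂ → ℂ)
    (hφ : DifferentiableOn ℂ φ (ball 0 1)) (hmaps : Set.MapsTo φ (ball 0 1) (ball 0 1))
    (hφbound : ∀ r ∈ Set.Ioo (0 : ℝ) 1,
      (1 - r) * (∫ ζ, (‖deriv φ (r • ζ.1)‖ / (1 - ‖φ (r • ζ.1)‖) *
          Ω (1 - ‖φ (r • ζ.1)‖)) ^ (2 * p) ∂sigma1) ^ (1 / (2 * p)) ≤ ω (1 - r))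
    (G H1 H2 : ℝ → ℝ) (C : ℝ) (hC : 0 < C)
    (hG1 : ∀ x ∈ Set.Ico (0:ℝ) 1, HasDerivAt (fun x => G x ^ p) (H1 x) x)
    (hG2 : ∀ x ∈ Set.Ico (0:ℝ) 1, HasDerivAt H1 (H2 x) x)
    (hH2c : ContinuousOn H2 (Set.Ico 0 1)) (hGc : ContinuousOn G (Set.Ico 0 1))
    (hGge : ∀ x ∈ Set.Ico (0:ℝ) 1, 1 ≤ G x)
    (hH : ∀ s ∈ Set.Ico (0:ℝ) 1, H1 (s ^ 2) + s ^ 2 * H2 (s ^ 2) ≤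
        C * (G (s ^ 2) ^ (p - 1) * (Ω (1 - s) / (1 - s)) ^ 2)) :
    ∃ M : ℝ, ∀ r ∈ Set.Ioo (0 : ℝ) 1, ∫ ζ : sphere (0:ℂ) 1, G (‖φ (r * ζ.1)‖ ^ 2) ^ p ∂sigma1 ≤ M := by
  have hp0 : 0 < p := by linarith
  have hH1c : ContinuousOn H1 (Set.Ico 0 1) := fun x hx => (hG2 x hx).continuousAt.continuousWithinAt
  have hφI : ∀ w ∈ ball (0:ℂ) 1, ‖φ w‖ ∈ Set.Ico (0:ℝ) 1 := by
    intro w hw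
    have := hmaps hw
    rw [mem_ball_zero_iff] at this
    exact ⟨norm_nonneg _, this⟩
  have hxI : ∀ w ∈ ball (0:ℂ) 1, ‖φ w‖ ^ 2 ∈ Set.Ico (0:ℝ) 1 := by
    intro w hw
    have := hφI w hw
    exact ⟨by positivity, by nlinarith [this.1, this.2]⟩
  have hGw : ContinuousOn (fun w => G (‖φ w‖ ^ 2)) (ball 0 1) := cont_H hφ hmaps hGc
  have hGpw : ContinuousOn (fun w => G (‖φ w‖ ^ 2) ^ p) (ball 0 1) :=
    hGw.rpow_const (fun _ _ => Or.inr hp0.le)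
  have hYw : ContinuousOn (fun w => ‖deriv φ w‖ / (1 - ‖φ w‖) * Ω (1 - ‖φ w‖)) (ball 0 1) := by
    have e1 : ContinuousOn (fun w => 1 - ‖φ w‖) (ball 0 1) :=
      continuousOn_const.sub hφ.continuousOn.norm
    refine ((hφ.deriv isOpen_ball).continuousOn.norm.div e1 ?_).mul (hΩc.comp e1 ?_)
    · intro w hw
      have := (hφI w hw).2
      linarith
    · intro w hw
      have := hφI w hw
      exact ⟨by linarith [this.2], by linarith [this.1]⟩
  have hY0 : ∀ w ∈ ball (0:ℂ) 1, 0 ≤ ‖deriv φ w‖ / (1 - ‖φ w‖) * Ω (1 - ‖φ w‖) := by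
    intro w hw
    have := hφI w hw
    have h1 : 0 < 1 - ‖φ w‖ := by linarith [this.2]
    have := hΩpos (1 - ‖φ w‖) ⟨h1, by linarith [this.1]⟩
    positivity
  obtain ⟨I, hI⟩ : ∃ I : ℝ → ℝ, I = fun v => ∫ ζ : sphere (0:ℂ) 1, G (‖φ (Real.exp v * ζ.1)‖ ^ 2) ^ p ∂sigma1 :=
    ⟨_, rfl⟩
  have hballr : ∀ r : ℝ, 0 ≤ r → r < 1 → ∀ ζ : sphere (0:ℂ) 1, (r * ζ.1 : ℂ) ∈ ball (0:ℂ) 1 := by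
    intro r h0 h1 ζ
    simp [abs_of_nonneg h0, h1]
  have hI0 : ∀ v, v < 0 → 0 ≤ I v := by
    intro v hv
    rw [hI]
    apply integral_nonneg
    intro ζ
    have := hGge _ (hxI _ (hballr _ (Real.exp_pos v).le (Real.exp_lt_one_iff.2 hv) ζ))
    exact Real.rpow_nonneg (by linarith) _
  have hexp0 : 0 ≤ 1 - 1 / p := by rw [sub_nonneg, div_le_one hp0]; exact hp
  -- inner estimate
  have hinner : ∀ v, v < 0 → ∫ ζ : sphere (0:ℂ) 1, 4 * ‖aF φ (Real.exp v * ζ.1)‖ ^ 2 *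
        (H1 (‖φ (Real.exp v * ζ.1)‖ ^ 2) + ‖φ (Real.exp v * ζ.1)‖ ^ 2 * H2 (‖φ (Real.exp v * ζ.1)‖ ^ 2)) ∂sigma1
      ≤ 4 * C * (I v ^ (1 - 1 / p) * (ω (1 - Real.exp v) / (1 - Real.exp v)) ^ 2) := by
    intro v hv
    have hr0 := Real.exp_pos v
    have hr1 : Real.exp v < 1 := Real.exp_lt_one_iff.2 hv
    have hmI : I v = ∫ ζ : sphere (0:ℂ) 1, G (‖φ (Real.exp v * ζ.1)‖ ^ 2) ^ p ∂sigma1 := by rw [hI]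
    rw [hmI]
    have hb := hφbound _ ⟨hr0, hr1⟩
    simp only [Complex.real_smul] at hb
    generalize Real.exp v = r at hr0 hr1 hb ⊢
    have hball := hballr r hr0.le hr1
    have cG := sph_cont hGpw hr0.le hr1
    have cY := (sph_cont hYw hr0.le hr1).rpow_const (p := 2 * p) (fun _ => Or.inr (by linarith))
    have hold := sph_holder cG cY
      (fun ζ => Real.rpow_nonneg (by linarith [hGge _ (hxI _ (hball ζ))]) _)
      (fun ζ => Real.rpow_nonneg (hY0 _ (hball ζ)) _) hexp0 (one_div_pos.2 hp0).le (by ring)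
    have cc : Continuous (fun ζ : sphere (0:ℂ) 1 => 4 * ‖aF φ (r * ζ.1)‖ ^ 2 *
        (H1 (‖φ (r * ζ.1)‖ ^ 2) + ‖φ (r * ζ.1)‖ ^ 2 * H2 (‖φ (r * ζ.1)‖ ^ 2))) := by
      refine sph_cont (f := fun w => 4 * ‖aF φ w‖ ^ 2 *
        (H1 (‖φ w‖ ^ 2) + ‖φ w‖ ^ 2 * H2 (‖φ w‖ ^ 2))) ?_ hr0.le hr1
      exact (continuousOn_const.mul ((cont_a hφ).norm.pow 2)).mul
        ((cont_H hφ hmaps hH1c).add ((hφ.continuousOn.norm.pow 2).mul (cont_H hφ hmaps hH2c)))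
    have cd : Continuous (fun ζ : sphere (0:ℂ) 1 => 4 * C * ((G (‖φ (r * ζ.1)‖ ^ 2) ^ p) ^ (1 - 1 / p) *
        ((‖deriv φ (r * ζ.1)‖ / (1 - ‖φ (r * ζ.1)‖) * Ω (1 - ‖φ (r * ζ.1)‖)) ^ (2 * p)) ^ (1 / p))) :=
      continuous_const.mul ((cG.rpow_const (fun _ => Or.inr hexp0)).mul
        (cY.rpow_const (fun _ => Or.inr (one_div_pos.2 hp0).le)))
    have step := integral_mono (sph_int cc) (sph_int cd) (by
      intro ζ
      simp only
      have hw := hball ζ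
      have hwn : ‖(r * ζ.1 : ℂ)‖ ≤ 1 := (mem_ball_zero_iff.1 hw).le
      generalize (r * ζ.1 : ℂ) = w at hw hwn ⊢
      have g1 := hGge _ (hxI w hw)
      have y0 := hY0 w hw
      have key := hH _ (hφI w hw)
      have e1 : (G (‖φ w‖ ^ 2) ^ p) ^ (1 - 1 / p) = G (‖φ w‖ ^ 2) ^ (p - 1) := by
        rw [← Real.rpow_mul (by linarith)]; congr 1; field_simp
      have e2 : ((‖deriv φ w‖ / (1 - ‖φ w‖) * Ω (1 - ‖φ w‖)) ^ (2 * p)) ^ (1 / p) =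
          (‖deriv φ w‖ / (1 - ‖φ w‖) * Ω (1 - ‖φ w‖)) ^ 2 := by
        rw [← Real.rpow_mul y0, ← Real.rpow_natCast]; congr 1; push_cast; field_simp
      rw [e1, e2]
      have a1 : ‖aF φ w‖ ≤ ‖deriv φ w‖ := by
        unfold aF; rw [norm_mul]
        exact mul_le_of_le_one_left (norm_nonneg _) hwn
      have a2 : 0 ≤ C * (G (‖φ w‖ ^ 2) ^ (p - 1) * (Ω (1 - ‖φ w‖) / (1 - ‖φ w‖)) ^ 2) := by
        have := Real.rpow_nonneg (by linarith : 0 ≤ G (‖φ w‖ ^ 2)) (p - 1)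
        positivity
      calc _ ≤ 4 * ‖aF φ w‖ ^ 2 * (C * (G (‖φ w‖ ^ 2) ^ (p - 1) * (Ω (1 - ‖φ w‖) / (1 - ‖φ w‖)) ^ 2)) := by
            gcongr
        _ ≤ 4 * ‖deriv φ w‖ ^ 2 * (C * (G (‖φ w‖ ^ 2) ^ (p - 1) * (Ω (1 - ‖φ w‖) / (1 - ‖φ w‖)) ^ 2)) := by
            gcongr
        _ = _ := by ring)
    refine step.trans ?_
    rw [integral_const_mul]
    have hIG : 0 ≤ ∫ ζ : sphere (0:ℂ) 1, G (‖φ (r * ζ.1)‖ ^ 2) ^ p ∂sigma1 :=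
      integral_nonneg (fun ζ => Real.rpow_nonneg (by linarith [hGge _ (hxI _ (hball ζ))]) _)
    refine mul_le_mul_of_nonneg_left (hold.trans ?_) (by positivity)
    refine mul_le_mul_of_nonneg_left ?_ (Real.rpow_nonneg hIG _)
    have hIY : 0 ≤ ∫ ζ : sphere (0:ℂ) 1, (‖deriv φ (r * ζ.1)‖ / (1 - ‖φ (r * ζ.1)‖) *
        Ω (1 - ‖φ (r * ζ.1)‖)) ^ (2 * p) ∂sigma1 :=
      integral_nonneg (fun ζ => Real.rpow_nonneg (hY0 _ (hball ζ)) _)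
    generalize (∫ ζ : sphere (0:ℂ) 1, (‖deriv φ (r * ζ.1)‖ / (1 - ‖φ (r * ζ.1)‖) *
        Ω (1 - ‖φ (r * ζ.1)‖)) ^ (2 * p) ∂sigma1) = M at hb hIY ⊢
    have e3 : M ^ (1 / p) = (M ^ (1 / (2 * p))) ^ 2 := by
      rw [← Real.rpow_natCast, ← Real.rpow_mul hIY]; congr 1; push_cast; field_simp
    rw [e3]
    have h1r : 0 < 1 - r := by linarith
    have : M ^ (1 / (2 * p)) ≤ ω (1 - r) / (1 - r) := by
      rw [le_div_iff₀ h1r]; linarith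
    have := Real.rpow_nonneg hIY (1 / (2 * p))
    gcongr
  have hwt := weight_int ω hωmono hωint
  obtain ⟨n, hn⟩ : ∃ n : ℝ → ℝ, n = fun v => Real.exp v * (ω (1 - Real.exp v) ^ 2 / (1 - Real.exp v)) := ⟨_, rfl⟩
  rw [← hn] at hwt
  have hn0 : ∀ v, v < 0 → 0 ≤ n v := by
    intro v hv
    have : 0 < 1 - Real.exp v := sub_pos.2 (Real.exp_lt_one_iff.2 hv)
    rw [hn]; positivity
  obtain ⟨W, hW⟩ : ∃ W, W = ∫ v in Set.Ioo (-1) 0, n v := ⟨_, rfl⟩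
  have hW0 : 0 ≤ W := by
    rw [hW]; exact setIntegral_nonneg measurableSet_Ioo (fun v hv => hn0 v hv.2)
  obtain ⟨D, hD⟩ : ∃ D, D = ∫ ζ : sphere (0:ℂ) 1, D1 H1 φ 1 (Real.exp (-1) * ζ.1) ∂sigma1 := ⟨_, rfl⟩
  have hmain : ∀ A : ℝ, 0 ≤ A → ∀ u, -1 ≤ u → u < 0 → (∀ v ∈ Set.Icc (-1) u, I v ≤ A) →
      I u ≤ (I (-1) + |D|) + (4 * C * Real.exp 2 * W) * A ^ (1 - 1 / p) := by
    intro A hA u hu hu0 hIA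
    obtain ⟨hint, heq⟩ := main_id hφ hmaps hG1 hG2 hH2c hu hu0
    have hIu : I u = ∫ ζ : sphere (0:ℂ) 1, G (‖φ (Real.exp u * ζ.1)‖ ^ 2) ^ p ∂sigma1 := by rw [hI]
    have hI1 : I (-1) = ∫ ζ : sphere (0:ℂ) 1, G (‖φ (Real.exp (-1) * ζ.1)‖ ^ 2) ^ p ∂sigma1 := by rw [hI]
    rw [← hIu, ← hI1, ← hD] at heq
    rw [heq]
    have hsub : Set.Ioc (-1) u ⊆ Set.Ioo (-1) 0 := fun v hv => ⟨hv.1, lt_of_le_of_lt hv.2 hu0⟩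
    have b1 : (u + 1) * D ≤ |D| := by
      have h1 := le_abs_self D
      have h2 := abs_nonneg D
      nlinarith
    have b2 := setIntegral_mono_on hint
      ((hwt.mono_set hsub).const_mul (4 * C * Real.exp 2 * A ^ (1 - 1 / p))) measurableSet_Ioc (by
      intro v hv
      have hv0 : v < 0 := (hsub hv).2
      have h1 := hinner v hv0
      have h2 : I v ^ (1 - 1 / p) ≤ A ^ (1 - 1 / p) :=
        Real.rpow_le_rpow (hI0 v hv0) (hIA v ⟨hv.1.le, hv.2⟩) hexp0
      have hAp := Real.rpow_nonneg hA (1 - 1 / p)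
      have h3 : 0 < 1 - Real.exp v := sub_pos.2 (Real.exp_lt_one_iff.2 hv0)
      have h4 : u - v ≤ Real.exp 2 * Real.exp v * (1 - Real.exp v) := by
        have c1 : -v + 1 ≤ Real.exp (-v) := Real.add_one_le_exp (-v)
        have c2 : Real.exp (-v) ≤ Real.exp 2 * Real.exp v := by
          rw [← Real.exp_add]; apply Real.exp_le_exp.2; linarith [hv.1]
        have c3 : Real.exp (-v) * Real.exp v = 1 := by rw [← Real.exp_add]; simp
        nlinarith
      have h5 : 0 ≤ u - v := by linarith [hv.2]
      calc _ ≤ (u - v) * (4 * C * (A ^ (1 - 1 / p) * (ω (1 - Real.exp v) / (1 - Real.exp v)) ^ 2)) := by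
            refine mul_le_mul_of_nonneg_left (h1.trans ?_) h5
            gcongr
        _ ≤ (Real.exp 2 * Real.exp v * (1 - Real.exp v)) *
            (4 * C * (A ^ (1 - 1 / p) * (ω (1 - Real.exp v) / (1 - Real.exp v)) ^ 2)) := by
            gcongr
        _ = _ := by
            rw [hn]; field_simp)
    rw [integral_const_mul] at b2
    have b3 : ∫ v in Set.Ioc (-1) u, n v ≤ W := by
      rw [hW]
      apply setIntegral_mono_set hwt
      · filter_upwards [ae_restrict_mem measurableSet_Ioo] with v hv
        exact hn0 v hv.2
      · exact hsub.eventuallyLE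
    have b4 : 4 * C * Real.exp 2 * A ^ (1 - 1 / p) * ∫ v in Set.Ioc (-1) u, n v ≤
        4 * C * Real.exp 2 * A ^ (1 - 1 / p) * W := by
      have hAp := Real.rpow_nonneg hA (1 - 1 / p)
      gcongr
    linarith
  obtain ⟨M0, hM0⟩ := sph_bdd hGpw (r0 := Real.exp (-1)) (Real.exp_lt_one_iff.2 (by norm_num))
  refine ⟨max M0 (max 1 (((I (-1) + |D|) + (4 * C * Real.exp 2 * W)) ^ p)), ?_⟩
  intro r hr
  rcases le_or_gt r (Real.exp (-1)) with h | h
  · exact le_max_of_le_left (hM0 r hr.1.le h)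
  · apply le_max_of_le_right
    obtain ⟨u, rfl⟩ : ∃ u, Real.exp u = r := ⟨Real.log r, Real.exp_log hr.1⟩
    have hu : -1 ≤ u := (Real.exp_lt_exp.1 h).le
    have hu0 : u < 0 := Real.exp_lt_one_iff.1 hr.2
    obtain ⟨M1, hM1⟩ := sph_bdd hGpw (r0 := Real.exp u) hr.2
    have hbdd : BddAbove (I '' Set.Icc (-1) u) := by
      refine ⟨M1, ?_⟩
      rintro _ ⟨v, hv, rfl⟩
      rw [hI]
      exact hM1 _ (Real.exp_pos v).le (Real.exp_le_exp.2 hv.2)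
    have hle : ∀ v ∈ Set.Icc (-1) u, I v ≤ sSup (I '' Set.Icc (-1) u) :=
      fun v hv => le_csSup hbdd ⟨v, hv, rfl⟩
    have humem : u ∈ Set.Icc (-1) u := ⟨hu, le_rfl⟩
    have hA0 : 0 ≤ sSup (I '' Set.Icc (-1) u) := (hI0 u hu0).trans (hle u humem)
    have hB0 : 0 ≤ 4 * C * Real.exp 2 * W := by positivity
    have hK0 : 0 ≤ I (-1) + |D| := add_nonneg (hI0 _ (by norm_num)) (abs_nonneg _)
    have hsup : sSup (I '' Set.Icc (-1) u) ≤ (I (-1) + |D|) +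
        (4 * C * Real.exp 2 * W) * sSup (I '' Set.Icc (-1) u) ^ (1 - 1 / p) := by
      apply csSup_le (Set.Nonempty.image I ⟨u, humem⟩)
      rintro _ ⟨v, hv, rfl⟩
      exact hmain _ hA0 v hv.1 (lt_of_le_of_lt hv.2 hu0) (fun v' hv' => hle v' ⟨hv'.1, hv'.2.trans hv.2⟩)
    have := (hle u humem).trans (absorb hp hK0 hB0 hsup)
    rw [hI] at this ⊢
    exact this

/-- hyperbolic-derivative estimate. If `∫_0^1 ω²(t)/t dt < ∞`,
`∫_0^1 Ω²(t)/t dt = ∞` and a holomorphic `φ : B_1 → B_1` satisfies the integral bound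
`(1-r) M_{2p}(|φ'|Ω(1-|φ|)/(1-|φ|), r) ≤ ω(1-r)`, then
`sup_{0<r<1} ∫_{S_1} Φ_Ω^p(1-|φ(rζ)|) dσ_1(ζ) < ∞`. -/
theorem stmt15 (ω Ω : ℝ → ℝ)
    (hωpos : ∀ t ∈ Set.Ioc (0 : ℝ) 1, 0 < ω t)
    (hωmono : MonotoneOn ω (Set.Ioc (0 : ℝ) 1))
    (hΩpos : ∀ t ∈ Set.Ioc (0 : ℝ) 1, 0 < Ω t)
    (hΩmono : MonotoneOn Ω (Set.Ioc (0 : ℝ) 1))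
    (hΩreg : ∃ ε : ℝ, 0 < ε ∧
      AntitoneOn (fun t : ℝ => Ω t / t ^ ((1 : ℝ) - ε)) (Set.Ioc (0 : ℝ) 1))
    (hωint : ∫⁻ t in Set.Ioc (0 : ℝ) 1, ENNReal.ofReal (ω t ^ 2 / t) < ⊤)
    (hΩint : ∫⁻ t in Set.Ioc (0 : ℝ) 1, ENNReal.ofReal (Ω t ^ 2 / t) = ⊤)
    (p : ℝ) (hp : 1 ≤ p)
    (φ : ℂ → ℂ)
    (hφhol : DifferentiableOn ℂ φ (ball 0 1))
    (hφmaps : Set.MapsTo φ (ball 0 1) (ball 0 1))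
    (hφbound : ∀ r ∈ Set.Ioo (0 : ℝ) 1,
      (1 - r) * (∫ ζ, (‖deriv φ (r • ζ.1)‖ / (1 - ‖φ (r • ζ.1)‖) *
          Ω (1 - ‖φ (r • ζ.1)‖)) ^ (2 * p) ∂sigma1) ^ (1 / (2 * p)) ≤ ω (1 - r)) :
    (⨆ r ∈ Set.Ioo (0 : ℝ) 1,
      ∫⁻ ζ, ENNReal.ofReal (Phi Ω (1 - ‖φ (r • ζ.1)‖) ^ p) ∂sigma1) < ⊤ := by
  obtain ⟨ε, hε, hreg⟩ := hΩreg
  obtain ⟨G, H1, H2, C, hC, hG1, hG2, hH2c, hGc, hGge, hPhi, hH⟩ :=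
    real_side Ω hΩpos hΩmono ε hε hreg p hp
  obtain ⟨M, hM⟩ := unif_bound ω Ω hωmono hωint (Omega_cont hΩmono hreg) hΩpos p hp φ hφhol hφmaps
    hφbound G H1 H2 C hC hG1 hG2 hH2c hGc hGge hH
  refine lt_of_le_of_lt ?_ (ENNReal.ofReal_lt_top (r := C ^ p * M))
  refine iSup₂_le fun r hr => ?_
  have hp0 : 0 < p := by linarith
  have hball : ∀ ζ : sphere (0:ℂ) 1, (r * ζ.1 : ℂ) ∈ ball (0:ℂ) 1 := by
    intro ζ
    simp [abs_of_nonneg hr.1.le, hr.2]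
  have hφI : ∀ ζ : sphere (0:ℂ) 1, ‖φ (r * ζ.1)‖ ∈ Set.Ico (0:ℝ) 1 := by
    intro ζ
    have := hφmaps (hball ζ)
    rw [mem_ball_zero_iff] at this
    exact ⟨norm_nonneg _, this⟩
  have hGpos : ∀ ζ : sphere (0:ℂ) 1, 0 ≤ G (‖φ (r * ζ.1)‖ ^ 2) := by
    intro ζ
    have := hφI ζ
    have := hGge (‖φ (r * ζ.1)‖ ^ 2) ⟨by positivity, by nlinarith [this.1, this.2]⟩
    linarith
  have hcont : Continuous (fun ζ : sphere (0:ℂ) 1 => C ^ p * G (‖φ (r * ζ.1)‖ ^ 2) ^ p) :=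
    continuous_const.mul ((sph_cont (cont_H hφhol hφmaps hGc) hr.1.le hr.2).rpow_const
      (fun _ => Or.inr hp0.le))
  calc ∫⁻ ζ : sphere (0:ℂ) 1, ENNReal.ofReal (Phi Ω (1 - ‖φ (r • ζ.1)‖) ^ p) ∂sigma1
      ≤ ∫⁻ ζ : sphere (0:ℂ) 1, ENNReal.ofReal (C ^ p * G (‖φ (r * ζ.1)‖ ^ 2) ^ p) ∂sigma1 := by
        refine lintegral_mono fun ζ => ENNReal.ofReal_le_ofReal ?_
        rw [Complex.real_smul, ← Real.mul_rpow hC.le (hGpos ζ)]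
        refine Real.rpow_le_rpow ?_ (hPhi _ (hφI ζ)) hp0.le
        unfold Phi
        have : 0 ≤ ∫ t in Set.Ioc (1 - ‖φ (r * ζ.1)‖) 1, Ω t ^ 2 / t := by
          apply setIntegral_nonneg measurableSet_Ioc
          intro t ht
          have h1 := (hφI ζ).2
          have h2 : 0 < t := by linarith [ht.1]
          positivity
        linarith
    _ = ENNReal.ofReal (∫ ζ : sphere (0:ℂ) 1, C ^ p * G (‖φ (r * ζ.1)‖ ^ 2) ^ p ∂sigma1) := by
        rw [ofReal_integral_eq_lintegral_ofReal (sph_int hcont)]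
        exact Eventually.of_forall fun ζ =>
          mul_nonneg (Real.rpow_nonneg hC.le _) (Real.rpow_nonneg (hGpos ζ) _)
    _ ≤ ENNReal.ofReal (C ^ p * M) := by
        apply ENNReal.ofReal_le_ofReal
        rw [integral_const_mul]
        exact mul_le_mul_of_nonneg_left (hM r hr) (Real.rpow_nonneg hC.le _)
end
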